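/- arXiv:1805.05285 — 7 statements merged into one kernel-verified Lean document; each statement's English description precedes it below -/
import Mathlib

section
/- For every ξ ∈ k^s, the sequence (q_1 − ξ_1, q_2 − ξ_2, ..., q_s − ξ_s) is a regular sequence in the polynomial ring R = k[x_1, ..., x_e, y_1, ..., y_e]. In particular the fiber μ^{-1}(ξ) of the moment map is cut out of W = k^{2e} by a regular sequence of length s. -/
open MvPolynomial

namespace MomentMapAux

/-- The regular sequence of affine forms in `k[z_1, …, z_e]`. -/
theorem affine_regular {k : Type*} [Field k] {s e : ℕ} (b : Fin e → Fin s → k)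
    (v : Fin s → Fin e → k)
    (hv : ∀ i j, ∑ a, b a j * v i a = if i = j then 1 else 0) (ξ : Fin s → k) :
    RingTheory.Sequence.IsRegular (MvPolynomial (Fin e) k)
      (List.ofFn fun j : Fin s => (∑ a : Fin e, C (b a j) * X a) - C (ξ j)) := by
  set g : Fin s → MvPolynomial (Fin e) k :=
    fun j => (∑ a : Fin e, C (b a j) * X a) - C (ξ j) with hg
  refine ⟨⟨fun m hm => ?_⟩, ?_⟩
  · have hm' : m < s := by simpa using hm
    set I : Ideal (MvPolynomial (Fin e) k) := Ideal.ofList ((List.ofFn g).take m) with hI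
    have hgI : ∀ i : Fin s, i.1 < m → g i ∈ I := by
      intro i hi
      refine Ideal.subset_span ?_
      simp only [Set.mem_ofPred_eq]
      rw [List.mem_take_iff_getElem]
      exact ⟨i.1, by simp [hi], by simp⟩
    let φ : MvPolynomial (Fin e) k →ₐ[k] MvPolynomial (Fin e) k :=
      aeval fun a => X a - ∑ i : Fin s, if i.1 < m then C (v i a) * g i else 0
    have hφ : ∀ f, f - φ f ∈ I := by
      intro f
      rw [← Ideal.Quotient.eq]
      have : (Ideal.Quotient.mkₐ k I) = (Ideal.Quotient.mkₐ k I).comp φ := by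
        ext a
        simp only [AlgHom.comp_apply, Ideal.Quotient.mkₐ_eq_mk]
        rw [Ideal.Quotient.eq]
        simp only [φ, aeval_X, sub_sub_cancel]
        refine Ideal.sum_mem _ fun i _ => ?_
        split_ifs with h
        · exact Ideal.mul_mem_left _ _ (hgI i h)
        · exact I.zero_mem
      exact DFunLike.congr_fun this f
    have hφg : ∀ j, φ (g j) = if j.1 < m then 0 else g j := by
      intro j
      have h1 : φ (g j) = g j - ∑ i : Fin s, if i.1 < m then
          C (∑ a, b a j * v i a) * g i else 0 := by
        have : ∀ i : Fin s, (if i.1 < m then C (∑ a, b a j * v i a) * g i else 0)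
            = ∑ a, C (b a j) * (if i.1 < m then C (v i a) * g i else 0) := by
          intro i
          split_ifs
          · simp [Finset.sum_mul, mul_assoc]
          · simp
        simp_rw [this]
        rw [Finset.sum_comm]
        simp_rw [← Finset.mul_sum]
        conv_lhs => simp only [hg]
        rw [map_sub, map_sum]
        simp only [map_mul, φ, aeval_X, algHom_C, algebraMap_eq, mul_sub, Finset.sum_sub_distrib]
        simp only [hg]
        ring
      rw [h1]
      simp_rw [hv]
      rw [Finset.sum_eq_single j]
      · rw [if_pos rfl]
        split_ifs <;> simp
      · intro i _ hij
        simp [hij]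
      · simp
    have hφI : ∀ f ∈ I, φ f = 0 := by
      have : I ≤ RingHom.ker φ := by
        rw [hI, Ideal.ofList, Ideal.span_le]
        intro x hx
        simp only [Set.mem_ofPred_eq] at hx
        rw [List.mem_take_iff_getElem] at hx
        obtain ⟨i, hi, rfl⟩ := hx
        have hi' : i < m := by omega
        simp only [List.getElem_ofFn, SetLike.mem_coe, RingHom.mem_ker]
        simpa [hi'] using hφg ⟨i, by omega⟩
      exact fun f hf => this hf
    have hne : g ⟨m, hm'⟩ ≠ 0 := by
      intro h0
      have := congrArg (eval fun a => (ξ ⟨m, hm'⟩ + 1) * v ⟨m, hm'⟩ a) h0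
      simp only [hg, map_sub, map_sum, map_mul, eval_C, eval_X, map_zero] at this
      have h2 : ∑ a, b a ⟨m, hm'⟩ * ((ξ ⟨m, hm'⟩ + 1) * v ⟨m, hm'⟩ a)
          = (ξ ⟨m, hm'⟩ + 1) * ∑ a, b a ⟨m, hm'⟩ * v ⟨m, hm'⟩ a := by
        rw [Finset.mul_sum]
        exact Finset.sum_congr rfl fun _ _ => by ring
      rw [h2, hv] at this
      simp at this
    rw [isSMulRegular_quotient_iff_mem_of_smul_mem]
    intro f hf
    simp only [smul_eq_mul, Ideal.mul_top, List.getElem_ofFn] at hf ⊢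
    have h3 := hφI _ hf
    rw [map_mul, hφg] at h3
    simp only [lt_irrefl, if_false, mul_eq_zero, hne, false_or] at h3
    have := hφ f
    rwa [h3, sub_zero] at this
  · intro h
    rw [smul_eq_mul, Ideal.mul_top] at h
    have hle : Ideal.ofList (List.ofFn g) ≤
        RingHom.ker (eval fun a => ∑ i, ξ i * v i a : MvPolynomial (Fin e) k →+* k) := by
      rw [Ideal.ofList, Ideal.span_le]
      intro x hx
      simp only [Set.mem_ofPred_eq, List.mem_ofFn] at hx
      obtain ⟨j, rfl⟩ := hx
      simp only [SetLike.mem_coe, RingHom.mem_ker, hg, map_sub, map_sum, map_mul, eval_C, eval_X]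
      simp_rw [Finset.mul_sum]
      rw [Finset.sum_comm]
      have : ∀ i, ∑ a, b a j * (ξ i * v i a) = ξ i * if i = j then 1 else 0 := by
        intro i
        rw [← hv, Finset.mul_sum]
        exact Finset.sum_congr rfl fun _ _ => by ring
      simp [this]
    rw [← h] at hle
    have : (1 : MvPolynomial (Fin e) k) ∈ RingHom.ker
      (eval fun a => ∑ i, ξ i * v i a : MvPolynomial (Fin e) k →+* k) := hle trivial
    simp [RingHom.mem_ker] at this

/-- The map `k[z] → k[x, y]`, `z_i ↦ x_i y_i`. -/
noncomputable def prodHom (k : Type*) [Field k] (e : ℕ) :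
    MvPolynomial (Fin e) k →ₐ[k] MvPolynomial (Fin e ⊕ Fin e) k :=
  aeval fun i => X (Sum.inl i) * X (Sum.inr i)

/-- Exponents of `x^n+ y^n-` times `(xy)^m`. -/
noncomputable def expEquiv (e : ℕ) :
    (Σ _ : Fin e → ℤ, (Fin e →₀ ℕ)) ≃ (Fin e ⊕ Fin e →₀ ℕ) where
  toFun p := Finsupp.equivFunOnFinite.symm
    (Sum.elim (fun i => p.2 i + (p.1 i).toNat) (fun i => p.2 i + (-p.1 i).toNat))
  invFun d := ⟨fun i => (d (Sum.inl i) : ℤ) - d (Sum.inr i),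
    Finsupp.equivFunOnFinite.symm fun i => min (d (Sum.inl i)) (d (Sum.inr i))⟩
  left_inv := by
    rintro ⟨w, n⟩
    refine Sigma.ext ?_ (heq_of_eq ?_)
    · funext i
      simp
    · ext i
      simp
      omega
  right_inv := by
    intro d
    ext i
    rcases i with i | i <;> simp <;> omega

/-- The monomial of weight `w`. -/
noncomputable def wMon (k : Type*) [Field k] (e : ℕ) (w : Fin e → ℤ) :
    MvPolynomial (Fin e ⊕ Fin e) k :=
  monomial (expEquiv e ⟨w, 0⟩) 1

theorem prodHom_monomial (k : Type*) [Field k] (e : ℕ) (w : Fin e → ℤ) (n : Fin e →₀ ℕ) :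
    prodHom k e (monomial n 1) * wMon k e w = monomial (expEquiv e ⟨w, n⟩) 1 := by
  rw [prodHom, aeval_monomial, map_one, one_mul, wMon]
  have : (n.prod fun i m => (X (Sum.inl i) * X (Sum.inr i) :
      MvPolynomial (Fin e ⊕ Fin e) k) ^ m) = monomial (expEquiv e ⟨0, n⟩) 1 := by
    rw [monomial_eq, C_1, one_mul, Finsupp.prod_fintype _ _ (by simp),
      Finsupp.prod_fintype _ _ (by simp), Fintype.prod_sum_type]
    simp [expEquiv, mul_pow, Finset.prod_mul_distrib]
  rw [this, monomial_mul, one_mul]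
  congr 2
  ext i
  rcases i with i | i <;> simp [expEquiv]

theorem free_prodHom (k : Type*) [Field k] (e : ℕ) :
    letI := (prodHom k e).toRingHom.toAlgebra
    Module.Free (MvPolynomial (Fin e) k) (MvPolynomial (Fin e ⊕ Fin e) k) := by
  let _ := (prodHom k e).toRingHom.toAlgebra
  have : IsScalarTower k (MvPolynomial (Fin e) k) (MvPolynomial (Fin e ⊕ Fin e) k) :=
    IsScalarTower.of_algebraMap_eq fun x => ((prodHom k e).commutes x).symm
  let L : ((Fin e → ℤ) →₀ MvPolynomial (Fin e) k) →ₗ[MvPolynomial (Fin e) k]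
      MvPolynomial (Fin e ⊕ Fin e) k := Finsupp.linearCombination _ (wMon k e)
  let E : ((Fin e → ℤ) →₀ MvPolynomial (Fin e) k) ≃ₗ[k] MvPolynomial (Fin e ⊕ Fin e) k :=
    (Finsupp.basis fun _ : Fin e → ℤ => basisMonomials (Fin e) k).equiv
      (basisMonomials (Fin e ⊕ Fin e) k) (expEquiv e)
  have hLE : L.restrictScalars k = E.toLinearMap := by
    refine (Finsupp.basis fun _ : Fin e → ℤ => basisMonomials (Fin e) k).ext ?_
    rintro ⟨w, n⟩
    rw [LinearEquiv.coe_coe, Module.Basis.equiv_apply, Finsupp.coe_basis]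
    simp only [LinearMap.restrictScalars_apply, L, Finsupp.linearCombination_single,
      coe_basisMonomials, Algebra.smul_def]
    exact prodHom_monomial k e w n
  have hbij : Function.Bijective L := by
    have : (L : _ → _) = E := funext fun x => DFunLike.congr_fun hLE x
    rw [this]
    exact E.bijective
  exact Module.Free.of_equiv (LinearEquiv.ofBijective L hbij)

end MomentMapAux

/-- **The fibers of the moment map are cut out by regular sequences.**
Let `k` be an algebraically closed field of characteristic `0` and let
`β 1, …, β e ∈ ℤ^s` span `ℚ^s` over `ℚ`.  In the polynomial ring
`R = k[x_1, …, x_e, y_1, …, y_e]` (variables indexed by `Fin e ⊕ Fin e`), set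
`q j = ∑ i, β i j * x i * y i`.  Then for every `ξ ∈ k^s` the sequence
`(q 1 - ξ 1, …, q s - ξ s)` is a regular sequence in `R`. -/
theorem moment_map_fiber_regular_sequence
    (k : Type*) [Field k] [IsAlgClosed k] [CharZero k]
    (s e : ℕ) (β : Fin e → Fin s → ℤ)
    (hspan : Submodule.span ℚ (Set.range fun i (j : Fin s) => (β i j : ℚ)) = ⊤)
    (ξ : Fin s → k) :
    RingTheory.Sequence.IsRegular (MvPolynomial (Fin e ⊕ Fin e) k)
      (List.ofFn fun j : Fin s =>
        (∑ i : Fin e, C (β i j : k) * X (Sum.inl i) * X (Sum.inr i)) - C (ξ j)) := by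
  classical
  have hw : ∀ j : Fin s, ∃ c : Fin e → ℚ,
      ∑ a, c a • (fun i : Fin s => (β a i : ℚ)) = Pi.single j 1 := by
    intro j
    rw [← Submodule.mem_span_range_iff_exists_fun, hspan]
    trivial
  choose w hw using hw
  have hv : ∀ i j : Fin s, ∑ a, (β a j : k) * ((w i a : ℚ) : k) = if i = j then 1 else 0 := by
    intro i j
    have h := congrArg (fun q : ℚ => (q : k)) (congrFun (hw i) j)
    simp only [Finset.sum_apply, Pi.smul_apply, smul_eq_mul, Pi.single_apply] at h
    push_cast at h
    rw [Finset.sum_congr rfl fun a _ => mul_comm _ _, h]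
    by_cases hij : i = j
    · simp [hij]
    · rw [if_neg hij, if_neg (Ne.symm hij), Rat.cast_zero]
  have hA := MomentMapAux.affine_regular (fun a j => (β a j : k)) (fun i a => ((w i a : ℚ) : k))
    hv ξ
  letI := (MomentMapAux.prodHom k e).toRingHom.toAlgebra
  haveI : Module.Free (MvPolynomial (Fin e) k) (MvPolynomial (Fin e ⊕ Fin e) k) :=
    MomentMapAux.free_prodHom k e
  have hR := RingTheory.Sequence.IsRegular.of_faithfullyFlat
    (S := MvPolynomial (Fin e ⊕ Fin e) k) hA
  rw [List.map_ofFn] at hR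
  have hfun : (fun j : Fin s =>
        (∑ i : Fin e, C (β i j : k) * X (Sum.inl i) * X (Sum.inr i)) - C (ξ j)) =
      (algebraMap (MvPolynomial (Fin e) k) (MvPolynomial (Fin e ⊕ Fin e) k)) ∘
        fun j : Fin s => (∑ a : Fin e, C (β a j : k) * X a) - C (ξ j) := by
    funext j
    change _ = MomentMapAux.prodHom k e _
    simp [MomentMapAux.prodHom, mul_assoc]
  rw [hfun]
  exact hR
end

section
/- The polynomial ring R = k[x_1, ..., x_e, y_1, ..., y_e] is flat as a module over the polynomial ring k[t_1, ..., t_s] via the k-algebra homomorphism sending t_j to q_j = Σ_{i=1}^e β_{ij} x_i y_i. In other words, the moment map μ : W → k^s is flat. -/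
open MvPolynomial

theorem mm_linear_indep (k : Type*) [Field k] [CharZero k]
    (s e : ℕ) (β : Fin e → Fin s → ℤ)
    (hspan : Submodule.span ℚ (Set.range fun i (j : Fin s) => (β i j : ℚ)) = ⊤) :
    LinearIndependent k (fun (j : Fin s) (i : Fin e) => (β i j : k)) := by
  rw [Fintype.linearIndependent_iff]
  intro c hc j
  have key : ∀ v : Fin s → ℚ, ∑ l, (v l : k) * c l = 0 := by
    intro v
    have hv : v ∈ Submodule.span ℚ (Set.range fun i (j : Fin s) => (β i j : ℚ)) := by
      rw [hspan]; trivial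
    induction hv using Submodule.span_induction with
    | mem x hx =>
      obtain ⟨i, rfl⟩ := hx
      have := congrFun hc i
      simpa [mul_comm] using this
    | zero => simp
    | add x y _ _ hx hy =>
      simp [add_mul, Finset.sum_add_distrib, hx, hy]
    | smul a x _ hx =>
      simp [mul_assoc, ← Finset.mul_sum, hx]
  have := key (Pi.single j 1)
  rw [Finset.sum_eq_single j] at this
  · simpa using this
  · intro b _ hb
    simp [Pi.single_eq_of_ne hb]
  · simp

theorem mm_flat_linear (k : Type*) [Field k] (s e : ℕ) (v : Fin s → Fin e → k)
    (hv : LinearIndependent k v) :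
    (aeval (fun j => ∑ i, C (v j i) * X i) :
      MvPolynomial (Fin s) k →ₐ[k] MvPolynomial (Fin e) k).toRingHom.Flat := by
  classical
  obtain ⟨κ, b, hb⟩ : ∃ (κ : Set (Fin e → k)) (b : Module.Basis (Fin s ⊕ κ) k (Fin e → k)),
      ∀ j, b (Sum.inl j) = v j :=
    ⟨_, Module.Basis.sumExtend hv, fun j => by
      simp only [Module.Basis.sumExtend, Module.Basis.reindex_apply, Module.Basis.extend_apply_self]
      rfl⟩
  have : Finite (Fin s ⊕ κ) := Module.Finite.finite_basis b
  have : Fintype (Fin s ⊕ κ) := Fintype.ofFinite _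
  let F : MvPolynomial (Fin s ⊕ κ) k →ₐ[k] MvPolynomial (Fin e) k :=
    aeval fun a => ∑ i, C (b a i) * X i
  let G : MvPolynomial (Fin e) k →ₐ[k] MvPolynomial (Fin s ⊕ κ) k :=
    aeval fun i => ∑ a, C (b.repr (Pi.single i 1) a) * X a
  have hFG : F.comp G = AlgHom.id k _ := by
    apply MvPolynomial.algHom_ext
    intro i
    simp only [AlgHom.comp_apply, F, G, aeval_X, map_sum, map_mul, aeval_C, algebraMap_eq,
      AlgHom.id_apply, Finset.mul_sum]
    rw [Finset.sum_comm]
    have h := b.sum_repr (Pi.single i 1)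
    have h2 : ∀ m, ∑ a, C (b.repr (Pi.single i 1) a) * (C (b a m) * X m)
        = C ((Pi.single i 1 : Fin e → k) m) * (X m : MvPolynomial (Fin e) k) := by
      intro m
      conv_rhs => rw [← h]
      simp [Finset.sum_apply, Finset.sum_mul, mul_assoc]
    rw [Finset.sum_congr rfl fun m _ => h2 m, Finset.sum_eq_single i]
    · simp
    · intro m _ hm; simp [Pi.single_eq_of_ne hm]
    · simp
  have hGF : G.comp F = AlgHom.id k _ := by
    apply MvPolynomial.algHom_ext
    intro a
    simp only [AlgHom.comp_apply, F, G, aeval_X, map_sum, map_mul, aeval_C, algebraMap_eq,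
      AlgHom.id_apply, Finset.mul_sum]
    rw [Finset.sum_comm]
    have h2 : ∀ c, ∑ m, C (b a m) * (C (b.repr (Pi.single m 1) c) * X c)
        = C (if a = c then 1 else 0) * (X c : MvPolynomial (Fin s ⊕ κ) k) := by
      intro c
      have h3 : (if a = c then 1 else 0) = ∑ m, b a m * b.repr (Pi.single m 1) c := by
        have h4 : b a = ∑ m, b a m • (Pi.single m 1 : Fin e → k) := by
          ext i; simp [Finset.sum_apply, Pi.single_apply]
        have h5 := congrArg (fun w => b.repr w c) h4
        simp only [Module.Basis.repr_self, map_sum, map_smul, Finsupp.single_apply] at h5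
        rw [h5]; simp [Finsupp.finsetSum_apply]
      rw [h3]
      simp [Finset.sum_mul, mul_assoc]
    rw [Finset.sum_congr rfl fun m _ => h2 m]
    simp
  have hFbij : Function.Bijective F :=
    ⟨Function.LeftInverse.injective (g := G) fun x => DFunLike.congr_fun hGF x,
      Function.RightInverse.surjective (g := G) fun x => DFunLike.congr_fun hFG x⟩
  have hC : (C : MvPolynomial (Fin s) k →+* MvPolynomial κ (MvPolynomial (Fin s) k)).Flat := by
    have : (algebraMap (MvPolynomial (Fin s) k) (MvPolynomial κ (MvPolynomial (Fin s) k))).Flat :=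
      RingHom.flat_algebraMap_iff.mpr inferInstance
    exact this
  let S := ((sumAlgEquiv k κ (Fin s)).symm.trans (renameEquiv k (Equiv.sumComm κ (Fin s))))
  have hS : (S : MvPolynomial κ (MvPolynomial (Fin s) k) →+* MvPolynomial (Fin s ⊕ κ) k).Flat :=
    RingHom.Flat.of_bijective S.bijective
  have hF : F.toRingHom.Flat := RingHom.Flat.of_bijective hFbij
  have := (hC.comp hS).comp hF
  convert this using 1
  apply MvPolynomial.ringHom_ext
  · intro r
    have h1 : (sumAlgEquiv k κ (Fin s)).symm (C (C r)) = C r := by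
      rw [AlgEquiv.symm_apply_eq]; simp
    simp [S, F, h1]
  · intro j
    have h1 : (sumAlgEquiv k κ (Fin s)).symm (C (X j)) = X (Sum.inr j) := by
      rw [AlgEquiv.symm_apply_eq]; simp
    simp [S, F, h1, hb]

/-- exponents -/
noncomputable def mmExp {e : ℕ} (d : Fin e → ℤ) (n : Fin e →₀ ℕ) : Fin e ⊕ Fin e →₀ ℕ :=
  Finsupp.equivFunOnFinite.symm
    (Sum.elim (fun i => n i + (d i).toNat) (fun i => n i + (-d i).toNat))

theorem mmExp_inj {e : ℕ} {d d' : Fin e → ℤ} {n n' : Fin e →₀ ℕ} :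
    mmExp d n = mmExp d' n' ↔ d = d' ∧ n = n' := by
  constructor
  · intro h
    have h1 : ∀ i, n i + (d i).toNat = n' i + (d' i).toNat := fun i => by
      simpa [mmExp] using DFunLike.congr_fun h (Sum.inl i)
    have h2 : ∀ i, n i + (-d i).toNat = n' i + (-d' i).toNat := fun i => by
      simpa [mmExp] using DFunLike.congr_fun h (Sum.inr i)
    constructor
    · ext i; have := h1 i; have := h2 i; omega
    · ext i; have := h1 i; have := h2 i; omega
  · rintro ⟨rfl, rfl⟩; rfl

theorem mmExp_surj {e : ℕ} (a : Fin e ⊕ Fin e →₀ ℕ) : ∃ d n, mmExp d n = a := by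
  refine ⟨fun i => (a (Sum.inl i) : ℤ) - a (Sum.inr i),
    Finsupp.equivFunOnFinite.symm fun i => min (a (Sum.inl i)) (a (Sum.inr i)), ?_⟩
  ext i
  rcases i with i | i <;> simp [mmExp] <;> omega

theorem mm_flat_prod (k : Type*) [Field k] (e : ℕ) :
    (aeval (fun i => X (Sum.inl i) * X (Sum.inr i)) :
      MvPolynomial (Fin e) k →ₐ[k] MvPolynomial (Fin e ⊕ Fin e) k).toRingHom.Flat := by
  classical
  set φ : MvPolynomial (Fin e) k →ₐ[k] MvPolynomial (Fin e ⊕ Fin e) k :=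
    aeval (fun i => X (Sum.inl i) * X (Sum.inr i)) with hφ
  have hmon : ∀ (d : Fin e → ℤ) (n : Fin e →₀ ℕ) (c : k),
      φ (monomial n c) * monomial (mmExp d 0) 1 = monomial (mmExp d n) c := by
    intro d n c
    have h1 : φ (monomial n c) = monomial (mmExp 0 n) c := by
      rw [hφ, aeval_monomial, monomial_eq (s := mmExp 0 n), algebraMap_eq]
      congr 1
      rw [Finsupp.prod_fintype _ _ (by simp), Finsupp.prod_fintype _ _ (by simp)]
      simp [mmExp, mul_pow, Finset.prod_mul_distrib]
    rw [h1, monomial_mul, mul_one]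
    congr 2
    apply Finsupp.ext
    intro i
    rcases i with i | i <;> simp [mmExp]
  have hcoeff : ∀ (p : MvPolynomial (Fin e) k) (d d' : Fin e → ℤ) (n : Fin e →₀ ℕ),
      coeff (mmExp d n) (φ p * monomial (mmExp d' 0) 1) = if d' = d then coeff n p else 0 := by
    intro p d d' n
    induction p using MvPolynomial.induction_on' with
    | monomial u a =>
      rw [hmon, coeff_monomial, coeff_monomial]
      simp only [mmExp_inj]
      split_ifs <;> simp_all
    | add p q hp hq =>
      rw [map_add, add_mul, coeff_add, hp, hq]
      split_ifs <;> simp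
  letI : Algebra (MvPolynomial (Fin e) k) (MvPolynomial (Fin e ⊕ Fin e) k) :=
    φ.toRingHom.toAlgebra
  have hsmul : ∀ (p : MvPolynomial (Fin e) k) (q : MvPolynomial (Fin e ⊕ Fin e) k),
    p • q = φ p * q := fun p q => rfl
  let w : (Fin e → ℤ) → MvPolynomial (Fin e ⊕ Fin e) k := fun d => monomial (mmExp d 0) 1
  have hli : LinearIndependent (MvPolynomial (Fin e) k) w := by
    rw [linearIndependent_iff']
    intro t g hg d hd
    ext n
    have := congrArg (coeff (mmExp d n)) hg
    simp only [hsmul, w, coeff_sum, hcoeff, Finset.sum_ite_eq', hd, if_true] at this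
    simpa using this
  have hsp : ⊤ ≤ Submodule.span (MvPolynomial (Fin e) k) (Set.range w) := by
    intro q _
    induction q using MvPolynomial.induction_on' with
    | monomial u a =>
      obtain ⟨d, n, rfl⟩ := mmExp_surj u
      rw [← hmon, ← hsmul]
      exact Submodule.smul_mem _ _ (Submodule.subset_span ⟨d, rfl⟩)
    | add p q hp hq => exact Submodule.add_mem _ (hp trivial) (hq trivial)
  have hfree : Module.Free (MvPolynomial (Fin e) k) (MvPolynomial (Fin e ⊕ Fin e) k) :=
    Module.Free.of_basis (Module.Basis.mk hli hsp)
  have hflat : Module.Flat (MvPolynomial (Fin e) k) (MvPolynomial (Fin e ⊕ Fin e) k) :=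
    inferInstance
  exact hflat

/-- **Flatness of the moment map.**
Let `k` be an algebraically closed field of characteristic `0` and let
`β 1, …, β e ∈ ℤ^s` span `ℚ^s` over `ℚ`.  The polynomial ring
`R = k[x_1, …, x_e, y_1, …, y_e]` is flat as a module over `k[t_1, …, t_s]` via the
`k`-algebra homomorphism `t j ↦ q j = ∑ i, β i j * x i * y i`; i.e. the moment map
`μ : W → k^s` is flat. -/
theorem moment_map_flat
    (k : Type*) [Field k] [IsAlgClosed k] [CharZero k]
    (s e : ℕ) (β : Fin e → Fin s → ℤ)
    (hspan : Submodule.span ℚ (Set.range fun i (j : Fin s) => (β i j : ℚ)) = ⊤) :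
    letI : Algebra (MvPolynomial (Fin s) k) (MvPolynomial (Fin e ⊕ Fin e) k) :=
      (MvPolynomial.aeval fun j : Fin s =>
        ∑ i : Fin e, C (β i j : k) * X (Sum.inl i) * X (Sum.inr i) :
          MvPolynomial (Fin s) k →ₐ[k] MvPolynomial (Fin e ⊕ Fin e) k).toRingHom.toAlgebra
    Module.Flat (MvPolynomial (Fin s) k) (MvPolynomial (Fin e ⊕ Fin e) k) := by
  have h := (mm_flat_linear k s e _ (mm_linear_indep k s e β hspan)).comp (mm_flat_prod k e)
  have heq : (aeval (fun j : Fin s =>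
        ∑ i : Fin e, C (β i j : k) * X (Sum.inl i) * X (Sum.inr i)) :
          MvPolynomial (Fin s) k →ₐ[k] MvPolynomial (Fin e ⊕ Fin e) k).toRingHom.Flat := by
    convert h using 1
    apply MvPolynomial.ringHom_ext
    · intro r
      simp
    · intro j
      simp [mul_assoc]
  exact heq
end

section
/- Let r be the dimension of the ℚ-linear span of β_1, ..., β_e in ℚ^s. Then the Krull dimension of the quotient ring R/(q_1, ..., q_s) equals 2e − r. In particular, if β_1, ..., β_e span ℚ^s, the zero fiber μ^{-1}(0) of the moment map has dimension 2e − s. -/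
open MvPolynomial

/-- Quotient by an extended ideal along an injective integral extension preserves dimension. -/
theorem dim_quot_of_integral {A B : Type*} [CommRing A] [CommRing B] [Algebra A B]
    [Algebra.IsIntegral A B] (hinj : Function.Injective (algebraMap A B)) (I : Ideal A) :
    ringKrullDim (B ⧸ I.map (algebraMap A B)) = ringKrullDim (A ⧸ I) := by
  rw [ringKrullDim_quotient, ringKrullDim_quotient]
  apply le_antisymm
  · refine Order.krullDim_le_of_strictMono
      (fun p => ⟨PrimeSpectrum.comap (algebraMap A B) p.1, ?_⟩) ?_
    · have := p.2
      rw [PrimeSpectrum.mem_zeroLocus, SetLike.coe_subset_coe] at this ⊢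
      exact Ideal.map_le_iff_le_comap.1 this
    · intro p q hpq
      exact Ideal.IsIntegral.comap_lt_comap (R := A) (I := p.1.asIdeal) (J := q.1.asIdeal) hpq
  · refine iSup_le fun l => ?_
    let l' : LTSeries (PrimeSpectrum A) := l.map Subtype.val (fun _ _ h => h)
    obtain ⟨P, -, hP, hPl⟩ := Ideal.exists_ideal_over_prime_of_isIntegral (S := B)
      l'.head.asIdeal ⊥ (by
        rw [← RingHom.ker_eq_comap_bot, (RingHom.injective_iff_ker_eq_bot _).1 hinj]
        exact bot_le)
    haveI : P.LiesOver l'.head.asIdeal := ⟨hPl.symm⟩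
    obtain ⟨L, hlen, hhead, -⟩ := Ideal.exists_ltSeries_of_hasGoingUp l' P
    have hI : I.map (algebraMap A B) ≤ P := by
      rw [Ideal.map_le_iff_le_comap, hPl]
      exact l.head.2
    let M : LTSeries (PrimeSpectrum.zeroLocus (R := B) (I.map (algebraMap A B))) :=
      { length := L.length
        toFun := fun i => ⟨L i, by
          rw [PrimeSpectrum.mem_zeroLocus, SetLike.coe_subset_coe]
          have h0 : L.head ≤ L i := L.head_le i
          rw [hhead] at h0
          exact hI.trans h0⟩
        step := fun i => L.step i }
    have := Order.LTSeries.length_le_krullDim M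
    have h2 : M.length = l.length := hlen
    rwa [h2] at this

/-- An integral extension has dimension at most that of the base. -/
theorem dim_le_of_integral {A B : Type*} [CommRing A] [CommRing B] [Algebra A B]
    [Algebra.IsIntegral A B] : ringKrullDim B ≤ ringKrullDim A := by
  refine Order.krullDim_le_of_strictMono (PrimeSpectrum.comap (algebraMap A B)) ?_
  intro p q hpq
  exact Ideal.IsIntegral.comap_lt_comap (R := A) (I := p.asIdeal) (J := q.asIdeal) hpq

/-- An integral endomorphism of a polynomial ring is injective. -/
theorem inj_of_integral {k σ : Type*} [Field k] [Finite σ]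
    (f : MvPolynomial σ k →+* MvPolynomial σ k) (hf : f.IsIntegral) : Function.Injective f := by
  rw [injective_iff_map_eq_zero]
  intro a ha
  by_contra hne
  have h1 := ringKrullDim_succ_le_of_surjective f.rangeRestrict f.rangeRestrict_surjective
    (mem_nonZeroDivisors_of_ne_zero hne) (by ext1; simpa using ha)
  haveI : Algebra.IsIntegral f.range (MvPolynomial σ k) := ⟨fun x => by
    obtain ⟨p, hp, hx⟩ := hf x
    refine ⟨p.map f.rangeRestrict, hp.map _, ?_⟩
    rw [Polynomial.eval₂_map]
    exact hx⟩
  have h2 := dim_le_of_integral (A := f.range) (B := MvPolynomial σ k)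
  have h3 := (add_le_add_left h2 1).trans h1
  rw [MvPolynomial.ringKrullDim_of_isNoetherianRing, ringKrullDim_eq_zero_of_field] at h3
  have h4 : ((Nat.card σ + 1 : ℕ) : WithBot ℕ∞) ≤ (Nat.card σ : ℕ) := by
    push_cast
    simpa using h3
  have := Nat.cast_le.1 h4
  omega

/-- The map `z_i ↦ x_i y_i`, `t_i ↦ x_i + y_i`. -/
noncomputable def symMap (k : Type*) [Field k] (e : ℕ) :
    MvPolynomial (Fin e ⊕ Fin e) k →ₐ[k] MvPolynomial (Fin e ⊕ Fin e) k :=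
  aeval (Sum.elim (fun i => X (Sum.inl i) * X (Sum.inr i))
    (fun i => X (Sum.inl i) + X (Sum.inr i)))

theorem symMap_integral (k : Type*) [Field k] (e : ℕ) :
    (symMap k e).toRingHom.IsIntegral := by
  have key : ∀ (i : Fin e) (u : MvPolynomial (Fin e ⊕ Fin e) k),
      u * u - (X (Sum.inl i) + X (Sum.inr i)) * u + X (Sum.inl i) * X (Sum.inr i) = 0 →
      (symMap k e).toRingHom.IsIntegralElem u := by
    intro i u hu
    refine ⟨Polynomial.X ^ 2 + (Polynomial.C (-X (Sum.inr i)) * Polynomial.X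
      + Polynomial.C (X (Sum.inl i))), ?_, ?_⟩
    · apply Polynomial.monic_X_pow_add
      exact lt_of_le_of_lt Polynomial.degree_linear_le (by norm_num)
    · simp [symMap, Polynomial.eval₂_add, Polynomial.eval₂_mul]
      linear_combination hu
  intro p
  induction p using MvPolynomial.induction_on with
  | C a =>
    have : (C a : MvPolynomial (Fin e ⊕ Fin e) k) = (symMap k e).toRingHom (C a) := by
      simp [symMap]
    rw [this]
    exact RingHom.isIntegralElem_map _
  | add p q hp hq => exact RingHom.IsIntegralElem.add _ hp hq
  | mul_X p i hp =>
    refine RingHom.IsIntegralElem.mul _ hp ?_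
    rcases i with i | i
    · exact key i _ (by ring)
    · exact key i _ (by ring)

/-- Linear form attached to a vector. -/
noncomputable def linForm (k : Type*) [Field k] (σ : Type*) [Fintype σ] :
    (σ → k) →ₗ[k] MvPolynomial σ k :=
  Fintype.linearCombination k (X : σ → MvPolynomial σ k)

theorem dim_quot_linear (k : Type*) [Field k] (σ τ : Type*) [Fintype σ] (w : τ → σ → k) :
    ringKrullDim (MvPolynomial σ k ⧸ Ideal.span (Set.range fun j => linForm k σ (w j))) =
      ((Fintype.card σ - Module.finrank k (Submodule.span k (Set.range w)) : ℕ) :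
        WithBot ℕ∞) := by
  classical
  set W := Submodule.span k (Set.range w) with hW
  set I := Ideal.span (Set.range fun j => linForm k σ (w j)) with hI
  let b := Module.finBasis k ((σ → k) ⧸ W)
  set n := Module.finrank k ((σ → k) ⧸ W) with hn
  have hn' : n = Fintype.card σ - Module.finrank k W := by
    have := W.finrank_quotient_add_finrank
    rw [Module.finrank_fintype_fun_eq_card] at this
    omega
  -- the linear map V → linear forms in n variables
  let g : (σ → k) →ₗ[k] MvPolynomial (Fin n) k :=
    (linForm k (Fin n)) ∘ₗ b.equivFun.toLinearMap ∘ₗ W.mkQ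
  let φ : MvPolynomial σ k →ₐ[k] MvPolynomial (Fin n) k :=
    aeval fun i => g (Pi.single i 1)
  have hφ : ∀ v, φ (linForm k σ v) = g v := by
    have : φ.toLinearMap ∘ₗ linForm k σ = g := by
      ext i
      simp [linForm, φ]
    intro v
    exact LinearMap.congr_fun this v
  have hIW : ∀ v ∈ W, linForm k σ v ∈ I := by
    have : W ≤ (I.restrictScalars k).comap (linForm k σ) := by
      rw [hW, Submodule.span_le]
      rintro _ ⟨j, rfl⟩
      exact Ideal.subset_span ⟨j, rfl⟩
    exact this
  let Φ : MvPolynomial σ k ⧸ I →ₐ[k] MvPolynomial (Fin n) k :=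
    Ideal.Quotient.liftₐ I φ (by
      intro a ha
      have : I ≤ RingHom.ker φ := by
        rw [hI, Ideal.span_le]
        rintro _ ⟨j, rfl⟩
        change φ _ = 0
        rw [hφ]
        have : W.mkQ (w j) = 0 := by
          rw [Submodule.mkQ_apply, Submodule.Quotient.mk_eq_zero]
          exact Submodule.subset_span ⟨j, rfl⟩
        simp only [g, LinearMap.comp_apply, this, map_zero]
      exact this ha)
  -- linear map from V/W
  let m : ((σ → k) ⧸ W) →ₗ[k] MvPolynomial σ k ⧸ I :=
    W.liftQ ((Ideal.Quotient.mkₐ k I).toLinearMap ∘ₗ linForm k σ) (by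
      intro v hv
      exact Ideal.Quotient.eq_zero_iff_mem.2 (hIW v hv))
  let Ψ : MvPolynomial (Fin n) k →ₐ[k] MvPolynomial σ k ⧸ I := aeval fun c => m (b c)
  have hΨ : ∀ v, Ψ (linForm k (Fin n) (b.equivFun v)) = m v := by
    have : Ψ.toLinearMap ∘ₗ linForm k (Fin n) ∘ₗ b.equivFun.toLinearMap = m := by
      apply b.ext
      intro c
      simp [linForm, Ψ, Fintype.linearCombination_apply, Finsupp.single_apply, Pi.single_apply]
    intro v
    exact LinearMap.congr_fun this v
  have h1 : Φ.comp Ψ = AlgHom.id k _ := by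
    ext1 c
    obtain ⟨v, hv⟩ := W.mkQ_surjective (b c)
    have e1 : Ψ (X c) = Ideal.Quotient.mk I (linForm k σ v) := by
      simp only [Ψ, aeval_X, ← hv]
      rfl
    have e2 : Φ (Ideal.Quotient.mk I (linForm k σ v)) = φ (linForm k σ v) := rfl
    simp only [AlgHom.comp_apply, AlgHom.id_apply]
    rw [e1, e2, hφ]
    simp only [g, LinearMap.comp_apply, hv]
    simp [linForm, Fintype.linearCombination_apply, Finsupp.single_apply, Pi.single_apply]
  have h2 : Ψ.comp Φ = AlgHom.id k _ := by
    apply Ideal.Quotient.algHom_ext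
    ext1 i
    have e2 : Φ (Ideal.Quotient.mk I (X i)) = φ (X i) := rfl
    change Ψ (Φ (Ideal.Quotient.mk I (X i))) = Ideal.Quotient.mk I (X i)
    rw [e2]
    simp only [φ, aeval_X, g, LinearMap.comp_apply]
    erw [hΨ]
    change Ideal.Quotient.mk I (linForm k σ (Pi.single i 1)) = _
    simp [linForm]
  rw [ringKrullDim_eq_of_ringEquiv (AlgEquiv.ofAlgHom Φ Ψ h1 h2).toRingEquiv,
    MvPolynomial.ringKrullDim_of_isNoetherianRing, ringKrullDim_eq_zero_of_field, ← hn']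
  simp

theorem finrank_span_baseChange (K L : Type*) [Field K] [Field L] [Algebra K L]
    {ι ι' : Type*} [Finite ι] [Finite ι'] (v : ι → ι' → K) :
    Module.finrank L (Submodule.span L (Set.range fun i => algebraMap K L ∘ v i)) =
      Module.finrank K (Submodule.span K (Set.range v)) := by
  obtain ⟨κ, a, ha, hsp, hli⟩ := exists_linearIndependent' K v
  haveI : Finite κ := Finite.of_injective a ha
  haveI := Fintype.ofFinite κ
  have hli' := linearIndependent_algebraMap_comp_iff (S := L) |>.2 hli
  rw [← hsp, finrank_span_eq_card hli, ← finrank_span_eq_card hli']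
  refine (fun (hspan : Submodule.span L (Set.range fun i => algebraMap K L ∘ v i) =
      Submodule.span L (Set.range fun i => algebraMap K L ∘ (v ∘ a) i) ) => by rw [hspan]) ?_
  apply le_antisymm
  · rw [Submodule.span_le]
    rintro _ ⟨i, rfl⟩
    have h : v i ∈ Submodule.span K (Set.range (v ∘ a)) := by
      rw [hsp]; exact Submodule.subset_span ⟨i, rfl⟩
    have hle : Submodule.span K (Set.range (v ∘ a)) ≤
        ((Submodule.span L (Set.range fun i => algebraMap K L ∘ (v ∘ a) i)).restrictScalars K).comap
          ((Algebra.linearMap K L).compLeft ι') := by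
      rw [Submodule.span_le]
      rintro _ ⟨c, rfl⟩
      exact Submodule.subset_span ⟨c, rfl⟩
    exact hle h
  · apply Submodule.span_mono
    rintro _ ⟨c, rfl⟩
    exact ⟨a c, rfl⟩

/-- **Dimension of the zero fiber of the moment map.**
Let `k` be an algebraically closed field of characteristic `0` and let
`β 1, …, β e ∈ ℤ^s`.  Let `r` be the dimension of the `ℚ`-linear span of the `β i`
in `ℚ^s`.  In `R = k[x_1, …, x_e, y_1, …, y_e]` set `q j = ∑ i, β i j * x i * y i`.
Then the Krull dimension of `R ⧸ (q 1, …, q s)` equals `2e - r`; in particular when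
the `β i` span `ℚ^s` the zero fiber `μ⁻¹(0)` has dimension `2e - s`. -/
theorem moment_map_zero_fiber_dimension
    (k : Type*) [Field k] [IsAlgClosed k] [CharZero k]
    (s e : ℕ) (β : Fin e → Fin s → ℤ) (r : ℕ)
    (hr : Module.finrank ℚ
      (Submodule.span ℚ (Set.range fun i (j : Fin s) => (β i j : ℚ))) = r) :
    ringKrullDim (MvPolynomial (Fin e ⊕ Fin e) k ⧸
      Ideal.span (Set.range fun j : Fin s =>
        ∑ i : Fin e, C (β i j : k) * X (Sum.inl i) * X (Sum.inr i))) = 2 * e - r := by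
  classical
  let w0 : Fin s → Fin e → k := fun j i => (β i j : k)
  let emb : (Fin e → k) →ₗ[k] (Fin e ⊕ Fin e → k) :=
    LinearMap.pi (Sum.elim (fun i => LinearMap.proj i) (fun _ => 0))
  have hemb : Function.Injective emb := by
    intro u v h
    ext i
    exact congrFun h (Sum.inl i)
  let w : Fin s → Fin e ⊕ Fin e → k := fun j => emb (w0 j)
  have hrank0 : Module.finrank k (Submodule.span k (Set.range w0)) = r := by
    let M : Matrix (Fin e) (Fin s) k := Matrix.of fun i j => (β i j : k)
    have h1 := M.rank_eq_finrank_span_cols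
    have h2 := M.rank_eq_finrank_span_row
    have h3 := finrank_span_baseChange ℚ k (fun i (j : Fin s) => (β i j : ℚ))
    have h4 : (fun i => algebraMap ℚ k ∘ (fun (j : Fin s) => (β i j : ℚ))) = M.row := by
      ext i j
      simp [M]
    rw [h4, hr, ← h2, h1] at h3
    exact h3
  have hrank : Module.finrank k (Submodule.span k (Set.range w)) = r := by
    have : Set.range w = emb '' Set.range w0 := by
      rw [← Set.range_comp]; rfl
    rw [this, ← Submodule.map_span, ← hrank0]
    exact (Submodule.equivMapOfInjective emb hemb _).finrank_eq.symm
  have hint := symMap_integral k e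
  have hinj := inj_of_integral _ hint
  have hdim := dim_quot_linear k (Fin e ⊕ Fin e) (Fin s) w
  set I := Ideal.span (Set.range fun j => linForm k (Fin e ⊕ Fin e) (w j)) with hI
  have hmap : Ideal.span (Set.range fun j : Fin s =>
        ∑ i : Fin e, C (β i j : k) * X (Sum.inl i) * X (Sum.inr i)) =
      I.map (symMap k e).toRingHom := by
    rw [hI, Ideal.map_span, ← Set.range_comp]
    congr 2
    ext1 j
    simp [linForm, Fintype.linearCombination_apply, w, emb, w0, symMap, MvPolynomial.smul_eq_C_mul,
      mul_assoc]
  have hfin : ringKrullDim (MvPolynomial (Fin e ⊕ Fin e) k ⧸ I.map (symMap k e).toRingHom) =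
      ringKrullDim (MvPolynomial (Fin e ⊕ Fin e) k ⧸ I) := by
    letI := (symMap k e).toRingHom.toAlgebra
    haveI : Algebra.IsIntegral (MvPolynomial (Fin e ⊕ Fin e) k)
      (MvPolynomial (Fin e ⊕ Fin e) k) := ⟨hint⟩
    exact dim_quot_of_integral hinj I
  rw [hmap, hfin, hdim, hrank, Fintype.card_sum, Fintype.card_fin, ← two_mul]
end

section
/- For every ξ ∈ k^s, the Krull dimension of the quotient ring R/(q_1 − ξ_1, ..., q_s − ξ_s) equals 2e − s. That is, every fiber μ^{-1}(ξ) of the moment map has dimension 2e − s. -/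
open MvPolynomial

/-- Krull dimension is invariant under injective integral extensions. -/
theorem ringKrullDim_eq_of_injective_integral {A S : Type*} [CommRing A] [CommRing S]
    (f : A →+* S) (hinj : Function.Injective f) (hint : f.IsIntegral) :
    ringKrullDim S = ringKrullDim A := by
  let _ : Algebra A S := f.toAlgebra
  have hI : Algebra.IsIntegral A S := ⟨hint⟩
  apply le_antisymm
  · refine Order.krullDim_le_of_strictMono (PrimeSpectrum.comap (algebraMap A S)) ?_
    intro p q hpq
    exact Ideal.IsIntegral.comap_lt_comap (R := A) (A := S) (I := p.asIdeal) (J := q.asIdeal) hpq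
  · refine iSup_le fun l => ?_
    obtain ⟨Q, -, hQ, hQ'⟩ := Ideal.exists_ideal_over_prime_of_isIntegral (S := S)
      (RelSeries.head l).asIdeal ⊥ (by
        intro x hx
        have : f x = 0 := hx
        rw [hinj (this.trans f.map_zero.symm)]
        exact Ideal.zero_mem _)
    have : Q.LiesOver (RelSeries.head l).asIdeal := ⟨hQ'.symm⟩
    obtain ⟨L, hL, -⟩ := Ideal.exists_ltSeries_of_hasGoingUp l Q
    rw [← hL]
    exact Order.LTSeries.length_le_krullDim L

/-- Gaussian elimination: selecting a basis among the weights. -/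
theorem exists_pivots
    (k : Type*) [Field k] [CharZero k]
    (s e : ℕ) (β : Fin e → Fin s → ℤ)
    (hspan : Submodule.span ℚ (Set.range fun i (j : Fin s) => (β i j : ℚ)) = ⊤) :
    ∃ (g : Fin s → Fin e) (N : Matrix (Fin s) (Fin s) k), Function.Injective g ∧
      Matrix.of (fun a j => (β (g a) j : k)) * N = 1 ∧
      N * Matrix.of (fun a j => (β (g a) j : k)) = 1 := by
  have hf : Module.finrank ℚ (Submodule.span ℚ (Set.range fun i (j : Fin s) => (β i j : ℚ))) = s := by
    rw [hspan]; simp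
  obtain ⟨f, hf1, -, hf3⟩ := Submodule.exists_fun_fin_finrank_span_eq ℚ
    (Set.range fun i (j : Fin s) => (β i j : ℚ))
  have key : ∃ f : Fin s → (Fin s → ℚ),
      (∀ i, f i ∈ Set.range fun i (j : Fin s) => (β i j : ℚ)) ∧ LinearIndependent ℚ f :=
    ⟨f ∘ Fin.cast hf.symm, fun i => hf1 _, hf3.comp _ (Fin.cast_injective _)⟩
  obtain ⟨f, hf1, hf3⟩ := key
  choose g hg using hf1
  let M : Matrix (Fin s) (Fin s) ℚ := Matrix.of (fun a j => (β (g a) j : ℚ))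
  have hM : M.row = f := by
    funext a
    exact hg a
  have hU : IsUnit M := by
    rw [← Matrix.linearIndependent_rows_iff_isUnit, hM]
    exact hf3
  obtain ⟨u, hu⟩ := hU
  have hmap : Matrix.of (fun a j => (β (g a) j : k)) = (algebraMap ℚ k).mapMatrix M := by
    ext a j
    simp [M]
  refine ⟨g, (algebraMap ℚ k).mapMatrix (u⁻¹).val, ?_, ?_, ?_⟩
  · intro a b hab
    apply hf3.injective
    rw [← hg a, ← hg b, hab]
  · rw [hmap, ← map_mul, ← hu, Units.mul_inv, map_one]
  · rw [hmap, ← map_mul, ← hu, Units.inv_mul, map_one]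

theorem sum_split {s e : ℕ} {S : Type*} [AddCommMonoid S] (g : Fin s → Fin e)
    (hg : Function.Injective g) (F : Fin e → S) :
    ∑ i, F i = ∑ a, F (g a) + ∑ i : {i // i ∉ Set.range g}, F i := by
  classical
  rw [← Fintype.sum_subtype_add_sum_subtype (fun i => i ∈ Set.range g) F]
  congr 1
  convert! (Fintype.sum_equiv (Equiv.ofInjective g hg) (fun a => F (g a))
    (fun i => F i.1) (fun a => rfl)).symm

theorem isIntegralElem_of_add_mul {A S : Type*} [CommRing A] [CommRing S] (f : A →+* S)
    (x y : S) (u c : A) (h1 : x * y = f c) (h2 : f u = x + y) : f.IsIntegralElem x := by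
  refine ⟨Polynomial.X ^ 2 - (Polynomial.C u * Polynomial.X - Polynomial.C c), ?_, ?_⟩
  · monicity!
  · simp only [Polynomial.eval₂_sub, Polynomial.eval₂_mul, Polynomial.eval₂_pow,
      Polynomial.eval₂_X, Polynomial.eval₂_C, ← h1, h2]
    ring

theorem exists_root_quadratic {L : Type*} [Field L] [IsAlgClosed L] (u c : L) :
    ∃ r : L, r * (u - r) = c := by
  obtain ⟨r, hr⟩ := IsAlgClosed.exists_root
    (Polynomial.X ^ 2 - (Polynomial.C u * Polynomial.X - Polynomial.C c)) (by
      have : (Polynomial.X ^ 2 - (Polynomial.C u * Polynomial.X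
          - Polynomial.C c)).degree = 2 := by compute_degree!
      rw [this]; norm_num)
  refine ⟨r, ?_⟩
  simp only [Polynomial.IsRoot, Polynomial.eval_sub, Polynomial.eval_mul, Polynomial.eval_pow,
    Polynomial.eval_X, Polynomial.eval_C] at hr
  linear_combination -hr

theorem exists_algClosed_embedding.{u, v} (k : Type u) [Field k] (A : Type v) [CommRing A] [IsDomain A]
    [Algebra k A] : ∃ (L : Type v) (_ : Field L) (_ : IsAlgClosed L) (_ : Algebra k L)
      (i : A →ₐ[k] L), Function.Injective i :=
  ⟨AlgebraicClosure (FractionRing A), inferInstance, inferInstance, inferInstance,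
    IsScalarTower.toAlgHom k A (AlgebraicClosure (FractionRing A)),
    by
      change Function.Injective (algebraMap A (AlgebraicClosure (FractionRing A)))
      rw [IsScalarTower.algebraMap_eq A (FractionRing A) (AlgebraicClosure (FractionRing A))]
      rw [RingHom.coe_comp]
      exact (RingHom.injective (algebraMap (FractionRing A) _)).comp (IsFractionRing.injective A (FractionRing A))⟩

theorem pivot_iff
    {k : Type*} [Field k]
    {s e : ℕ} (β : Fin e → Fin s → ℤ) (ξ : Fin s → k)
    (g : Fin s → Fin e) (N : Matrix (Fin s) (Fin s) k) (hg : Function.Injective g)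
    (hMN : Matrix.of (fun a j => (β (g a) j : k)) * N = 1)
    (hNM : N * Matrix.of (fun a j => (β (g a) j : k)) = 1)
    (S : Type*) [CommRing S] [Algebra k S] (z : Fin e → S) :
      (∀ j, ∑ i, algebraMap k S (β i j : k) * z i - algebraMap k S (ξ j) = 0) ↔
      ∀ a, z (g a) = algebraMap k S (∑ j, ξ j * N j a) -
        ∑ i : {i // i ∉ Set.range g}, algebraMap k S (∑ j, (β i j : k) * N j a) * z i := by
  set M : Matrix (Fin s) (Fin s) k := Matrix.of (fun a j => (β (g a) j : k)) with hMdef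
  let v : Fin s → S := fun j => ∑ i, algebraMap k S (β i j : k) * z i - algebraMap k S (ξ j)
  let w : Fin s → S := fun a => z (g a) - (algebraMap k S (∑ j, ξ j * N j a) -
        ∑ i : {i // i ∉ Set.range g}, algebraMap k S (∑ j, (β i j : k) * N j a) * z i)
  let N' := (algebraMap k S).mapMatrix N
  let M' := (algebraMap k S).mapMatrix M
  have hNM' : N' * M' = 1 := by simp only [N', M', ← map_mul, hNM, map_one]
  have hw : w = Matrix.vecMul v N' := by
    funext a
    have h1 : ∑ i, algebraMap k S (∑ j, (β i j : k) * N j a) * z i =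
        z (g a) + ∑ i : {i // i ∉ Set.range g},
          algebraMap k S (∑ j, (β i j : k) * N j a) * z i := by
      rw [sum_split g hg]
      congr 1
      have h2 : ∀ b, ∑ j, (β (g b) j : k) * N j a = if b = a then 1 else 0 := by
        intro b
        have := congrFun (congrFun hMN b) a
        rw [Matrix.mul_apply, Matrix.one_apply] at this
        simpa [hMdef] using this
      simp [h2]
    have h3 : Matrix.vecMul v N' a =
        ∑ i, algebraMap k S (∑ j, (β i j : k) * N j a) * z i
          - algebraMap k S (∑ j, ξ j * N j a) := by
      simp only [Matrix.vecMul, dotProduct, v, N', sub_mul, Finset.sum_sub_distrib, map_sum,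
        map_mul, Finset.sum_mul, RingHom.mapMatrix_apply, Matrix.map_apply]
      rw [Finset.sum_comm]
      congr 1
      refine Finset.sum_congr rfl fun i _ => Finset.sum_congr rfl fun j _ => ?_
      ring
    rw [h3, h1]
    simp only [w]
    ring
  have hv : v = Matrix.vecMul w M' := by
    rw [hw, Matrix.vecMul_vecMul, hNM', Matrix.vecMul_one]
  constructor
  · intro h
    have : v = 0 := funext h
    rw [this, Matrix.zero_vecMul] at hw
    intro a
    exact sub_eq_zero.mp (congrFun hw a)
  · intro h
    have : w = 0 := funext fun a => sub_eq_zero.mpr (h a)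
    rw [this, Matrix.zero_vecMul] at hv
    exact congrFun hv

theorem moment_map_fiber_dimension
    (k : Type*) [Field k] [IsAlgClosed k] [CharZero k]
    (s e : ℕ) (β : Fin e → Fin s → ℤ)
    (hspan : Submodule.span ℚ (Set.range fun i (j : Fin s) => (β i j : ℚ)) = ⊤)
    (ξ : Fin s → k) :
    ringKrullDim (MvPolynomial (Fin e ⊕ Fin e) k ⧸
      Ideal.span (Set.range fun j : Fin s =>
        (∑ i : Fin e, C (β i j : k) * X (Sum.inl i) * X (Sum.inr i)) - C (ξ j))) =
      2 * e - s := by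
  classical
  obtain ⟨g, N, hg, hMN, hNM⟩ := exists_pivots k s e β hspan
  set I := Ideal.span (Set.range fun j : Fin s =>
        (∑ i : Fin e, C (β i j : k) * X (Sum.inl i) * X (Sum.inr i)) - C (ξ j) :
          Set (MvPolynomial (Fin e ⊕ Fin e) k)) with hI
  let mk := Ideal.Quotient.mkₐ k I
  -- the Noether normalization
  let φ : (MvPolynomial ({i // i ∉ Set.range g} ⊕ Fin e) k) →ₐ[k] (MvPolynomial (Fin e ⊕ Fin e) k ⧸ I) :=
    aeval (Sum.elim (fun i => mk (X (Sum.inl i.1)))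
      (fun i => if i ∈ Set.range g then mk (X (Sum.inl i)) + mk (X (Sum.inr i))
        else mk (X (Sum.inr i))))
  let F : Fin s → (MvPolynomial ({i // i ∉ Set.range g} ⊕ Fin e) k) := fun a => algebraMap k (MvPolynomial ({i // i ∉ Set.range g} ⊕ Fin e) k) (∑ j, ξ j * N j a) -
        ∑ i : {i // i ∉ Set.range g}, algebraMap k (MvPolynomial ({i // i ∉ Set.range g} ⊕ Fin e) k) (∑ j, (β i j : k) * N j a) *
          (X (Sum.inl i) * X (Sum.inr i.1))
  have hrel : ∀ a, mk (X (Sum.inl (g a))) * mk (X (Sum.inr (g a))) = φ (F a) := by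
    have := (pivot_iff β ξ g N hg hMN hNM _
      (fun i => mk (X (Sum.inl i)) * mk (X (Sum.inr i)))).mp (by
        intro j
        have h0 : mk ((∑ i : Fin e, C (β i j : k) * X (Sum.inl i) * X (Sum.inr i)) - C (ξ j)) = 0 :=
          Ideal.Quotient.eq_zero_iff_mem.mpr (Ideal.subset_span ⟨j, rfl⟩)
        rw [← h0, map_sub, map_sum]
        simp only [map_mul, ← MvPolynomial.algebraMap_eq, AlgHom.commutes, mul_assoc])
    intro a
    rw [this a]
    simp only [F, map_sub, map_sum (φ), map_mul φ, AlgHom.commutes]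
    congr 1
    refine Finset.sum_congr rfl fun i _ => ?_
    congr 1
    simp only [φ, aeval_X, Sum.elim_inl, Sum.elim_inr, if_neg i.2]
  have hφl : ∀ i (hi : i ∉ Set.range g), φ (X (Sum.inl ⟨i, hi⟩)) = mk (X (Sum.inl i)) := by
    intro i hi
    simp only [φ, aeval_X, Sum.elim_inl]
  have hφr : ∀ i (hi : i ∉ Set.range g), φ (X (Sum.inr i)) = mk (X (Sum.inr i)) := by
    intro i hi
    simp only [φ, aeval_X, Sum.elim_inr, if_neg hi]
  have hφg : ∀ a, φ (X (Sum.inr (g a))) = mk (X (Sum.inl (g a))) + mk (X (Sum.inr (g a))) := by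
    intro a
    simp only [φ, aeval_X, Sum.elim_inr, if_pos (Set.mem_range_self a)]
  have hint : φ.toRingHom.IsIntegral := by
    have hx : ∀ a, φ.toRingHom.IsIntegralElem (mk (X (Sum.inl (g a)))) := by
      intro a
      exact isIntegralElem_of_add_mul φ.toRingHom _ _ _ _ (hrel a) (hφg a)
    have hX : ∀ n, φ.toRingHom.IsIntegralElem (mk (X n)) := by
      rintro (i | i)
      · by_cases hi : i ∈ Set.range g
        · obtain ⟨a, rfl⟩ := hi
          exact hx a
        · rw [← hφl i hi]
          exact φ.toRingHom.isIntegralElem_map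
      · by_cases hi : i ∈ Set.range g
        · obtain ⟨a, rfl⟩ := hi
          have : mk (X (Sum.inr (g a))) = φ (X (Sum.inr (g a))) - mk (X (Sum.inl (g a))) := by
            rw [hφg]; ring
          rw [this]
          exact RingHom.IsIntegralElem.sub _ φ.toRingHom.isIntegralElem_map (hx a)
        · rw [← hφr i hi]
          exact φ.toRingHom.isIntegralElem_map
    intro r
    obtain ⟨p, rfl⟩ := Ideal.Quotient.mkₐ_surjective k I r
    change φ.toRingHom.IsIntegralElem (mk p)
    induction p using MvPolynomial.induction_on with
    | C c =>
      rw [← MvPolynomial.algebraMap_eq, AlgHom.commutes, ← φ.commutes]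
      exact φ.toRingHom.isIntegralElem_map
    | add p q hp hq => rw [map_add]; exact RingHom.IsIntegralElem.add _ hp hq
    | mul_X p n hp => rw [map_mul]; exact RingHom.IsIntegralElem.mul _ hp (hX n)
  have hinj : Function.Injective φ.toRingHom := by
    obtain ⟨L, _, _, _, ι, hι⟩ := exists_algClosed_embedding k
      (MvPolynomial ({i // i ∉ Set.range g} ⊕ Fin e) k)
    have hroot : ∀ a, ∃ r : L, r * (ι (X (Sum.inr (g a))) - r) = ι (F a) := fun a =>
      exists_root_quadratic _ _
    choose r hr using hroot
    let xv : Fin e → L := fun i => if h : i ∈ Set.range g then r h.choose else ι (X (Sum.inl ⟨i, h⟩))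
    have hxg : ∀ a, xv (g a) = r a := by
      intro a
      have h : g a ∈ Set.range g := ⟨a, rfl⟩
      simp only [xv, dif_pos h]
      rw [hg h.choose_spec]
    have hxn : ∀ i (hi : i ∉ Set.range g), xv i = ι (X (Sum.inl ⟨i, hi⟩)) := by
      intro i hi
      simp only [xv, dif_neg hi]
    let yv : Fin e → L := fun i => if i ∈ Set.range g then ι (X (Sum.inr i)) - xv i
      else ι (X (Sum.inr i))
    have hyg : ∀ a, yv (g a) = ι (X (Sum.inr (g a))) - r a := by
      intro a
      simp only [yv, if_pos (Set.mem_range_self a), hxg]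
    have hyn : ∀ i (hi : i ∉ Set.range g), yv i = ι (X (Sum.inr i)) := by
      intro i hi
      simp only [yv, if_neg hi]
    have hL := (pivot_iff β ξ g N hg hMN hNM L (fun i => xv i * yv i)).mpr (by
      intro a
      rw [hxg, hyg, hr]
      simp only [F, map_sub, map_sum ι, map_mul ι, AlgHom.commutes]
      congr 1
      refine Finset.sum_congr rfl fun i _ => ?_
      rw [hxn _ i.2, hyn _ i.2])
    let ψ₀ : MvPolynomial (Fin e ⊕ Fin e) k →ₐ[k] L := aeval (Sum.elim xv yv)
    have hψ₀ : ∀ p ∈ I, ψ₀ p = 0 := by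
      intro p hp
      have : I ≤ RingHom.ker ψ₀ := by
        rw [hI, Ideal.span_le]
        rintro _ ⟨j, rfl⟩
        change ψ₀ _ = 0
        rw [← hL j, map_sub, map_sum]
        simp only [map_mul, ← MvPolynomial.algebraMap_eq, AlgHom.commutes, mul_assoc]
        simp only [ψ₀, aeval_X, Sum.elim_inl, Sum.elim_inr]
      exact this hp
    let ψ : (MvPolynomial (Fin e ⊕ Fin e) k ⧸ I) →ₐ[k] L := Ideal.Quotient.liftₐ I ψ₀ hψ₀
    have hψ : ∀ n, ψ (mk (X n)) = Sum.elim xv yv n := by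
      intro n
      have : ψ (mk (X n)) = ψ₀ (X n) := rfl
      rw [this]
      simp only [ψ₀, aeval_X]
    have hcomp : ψ.comp φ = ι := by
      apply MvPolynomial.algHom_ext
      rintro (⟨i, hi⟩ | i)
      · rw [AlgHom.comp_apply, hφl, hψ, Sum.elim_inl, hxn]
      · by_cases hi : i ∈ Set.range g
        · obtain ⟨a, rfl⟩ := hi
          rw [AlgHom.comp_apply, hφg, map_add, hψ, hψ, Sum.elim_inl, Sum.elim_inr, hxg, hyg]
          ring
        · rw [AlgHom.comp_apply, hφr i hi, hψ, Sum.elim_inr, hyn i hi]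
    have : Function.Injective (ψ ∘ φ) := by
      have h : (ψ ∘ φ) = ι := by rw [← hcomp]; rfl
      rw [h]; exact hι
    exact this.of_comp
  rw [ringKrullDim_eq_of_injective_integral φ.toRingHom hinj hint]
  rw [MvPolynomial.ringKrullDim_of_isNoetherianRing, ringKrullDim_eq_zero_of_field]
  have hcard : Nat.card ({i // i ∉ Set.range g} ⊕ Fin e) = 2 * e - s := by
    have h1 : Fintype.card {i // i ∉ Set.range g} = e - s := by
      have h2 : Fintype.card {i // i ∈ Set.range g} = s := by
        rw [← Fintype.card_congr (Equiv.ofInjective g hg), Fintype.card_fin]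
      rw [Fintype.card_subtype_compl, h2, Fintype.card_fin]
    have h3 : s ≤ e := by simpa using Fintype.card_le_of_injective g hg
    rw [Nat.card_eq_fintype_card, Fintype.card_sum, h1, Fintype.card_fin]
    omega
  rw [hcard, zero_add]
end

section
/- Fix a point (x, y) ∈ k^e × k^e. The linear map k^e × k^e → k^s given by (u, v) ↦ (Σ_{i=1}^e β_{ij} (y_i u_i + x_i v_i))_{j=1}^s (the differential of the moment map μ at (x, y)) is surjective if and only if the set of weight vectors { β_i : x_i ≠ 0 or y_i ≠ 0 } spans k^s. Consequently, μ is smooth exactly at the points whose stabilizer in T = (k^×)^s is finite. -/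
/-- **Smooth locus of the moment map.**
Let `k` be an algebraically closed field of characteristic `0` and let
`β 1, …, β e ∈ ℤ^s`.  Fix a point `(x, y) ∈ k^e × k^e`.  The differential of the
moment map at `(x, y)`, i.e. the linear map
`(u, v) ↦ (∑ i, β i j * (y i * u i + x i * v i))_j : k^e × k^e → k^s`,
is surjective if and only if the set of weight vectors `{β i : x i ≠ 0 or y i ≠ 0}`
spans `k^s`.  (Consequently `μ` is smooth exactly at the points with finite
stabilizer in `T = (kˣ)^s`.) -/
theorem moment_map_differential_surjective_iff
    (k : Type*) [Field k] [IsAlgClosed k] [CharZero k]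
    (s e : ℕ) (β : Fin e → Fin s → ℤ)
    (x y : Fin e → k) :
    (Function.Surjective fun (uv : (Fin e → k) × (Fin e → k)) (j : Fin s) =>
        ∑ i : Fin e, (β i j : k) * (y i * uv.1 i + x i * uv.2 i)) ↔
      Submodule.span k
        ((fun i (j : Fin s) => (β i j : k)) '' {i : Fin e | x i ≠ 0 ∨ y i ≠ 0}) = ⊤ := by
  constructor
  · intro h
    rw [eq_top_iff]
    intro w _
    obtain ⟨uv, rfl⟩ := h w
    have key : (fun j : Fin s => ∑ i : Fin e, (β i j : k) * (y i * uv.1 i + x i * uv.2 i)) =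
        ∑ i : Fin e, (y i * uv.1 i + x i * uv.2 i) • (fun j : Fin s => (β i j : k)) := by
      funext j
      simp [Finset.sum_apply, mul_comm]
    change (fun j : Fin s => ∑ i : Fin e, (β i j : k) * (y i * uv.1 i + x i * uv.2 i)) ∈ _
    rw [key]
    refine Submodule.sum_mem _ fun i _ => ?_
    by_cases hi : x i ≠ 0 ∨ y i ≠ 0
    · exact Submodule.smul_mem _ _ (Submodule.subset_span ⟨i, hi, rfl⟩)
    · push Not at hi
      simp [hi.1, hi.2]
  · intro h w
    have hw : w ∈ Submodule.span k
        ((fun i (j : Fin s) => (β i j : k)) '' {i : Fin e | x i ≠ 0 ∨ y i ≠ 0}) := by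
      rw [h]; trivial
    induction hw using Submodule.span_induction with
    | mem w hw =>
      obtain ⟨i, hi, rfl⟩ := hw
      rcases hi with hi | hi
      · refine ⟨(0, Pi.single i (x i)⁻¹), ?_⟩
        funext j
        simp only [Pi.zero_apply, mul_zero, zero_add]
        rw [Finset.sum_eq_single i]
        · simp [hi]
        · intro b _ hb
          simp [hb]
        · simp
      · refine ⟨(Pi.single i (y i)⁻¹, 0), ?_⟩
        funext j
        simp only [Pi.zero_apply, mul_zero, add_zero]
        rw [Finset.sum_eq_single i]
        · simp [hi]
        · intro b _ hb
          simp [hb]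
        · simp
    | zero => exact ⟨0, by funext j; simp⟩
    | add a b _ _ ha hb =>
      obtain ⟨p, rfl⟩ := ha
      obtain ⟨q, rfl⟩ := hb
      refine ⟨p + q, ?_⟩
      funext j
      simp only [Prod.fst_add, Prod.snd_add, Pi.add_apply, ← Finset.sum_add_distrib]
      exact Finset.sum_congr rfl fun i _ => by ring
    | smul c a _ ha =>
      obtain ⟨p, rfl⟩ := ha
      refine ⟨c • p, ?_⟩
      funext j
      simp only [Prod.smul_fst, Prod.smul_snd, Pi.smul_apply, smul_eq_mul, Finset.mul_sum]
      exact Finset.sum_congr rfl fun i _ => by ring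
end

section
/- Assume that β_1, ..., β_e span ℚ^s and that for every index i_0 ∈ {1, ..., e} the remaining vectors { β_i : i ≠ i_0 } still span ℚ^s. Let S ⊆ {1, ..., e} be a subset with dim_ℚ span{ β_i : i ∈ S } < s. Then the Krull dimension of the quotient ring R/(I_S + (q_1, ..., q_s)), where I_S is the ideal generated by all variables x_i, y_i with i ∉ S, is at most (2e − s) − 3. That is, the intersection of the zero fiber μ^{-1}(0) of the moment map with the coordinate subspace W_S (a T-invariant subspace with positive-dimensional generic stabilizer) has codimension at least 3 in μ^{-1}(0). -/
open MvPolynomial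

/-- An integral ring homomorphism does not raise the Krull dimension of the target above
that of the source (incomparability). -/
theorem ringKrullDim_le_of_isIntegral_hom {A B : Type*} [CommRing A] [CommRing B]
    (f : A →+* B) (hf : f.IsIntegral) : ringKrullDim B ≤ ringKrullDim A := by
  algebraize [f]
  refine Order.krullDim_le_of_strictMono (PrimeSpectrum.comap f) ?_
  intro p q hpq
  have := p.2
  exact Ideal.IsIntegral.comap_lt_comap (R := A) (I := p.asIdeal) (J := q.asIdeal) hpq

/-- Dimension bound for a ring generated by `x i, y i` such that `x i = y i = 0` off `S`, and
`x b * y b` for `b ∈ B ⊆ S` is a combination of the `x i * y i` with `i ∈ S \ B`. -/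
theorem ringKrullDim_le_of_relations {k ι Q : Type*} [Field k] [DecidableEq ι]
    [CommRing Q] [Algebra k Q] (g : MvPolynomial (ι ⊕ ι) k →ₐ[k] Q)
    (hg : Function.Surjective g) (S B : Finset ι)
    (hx : ∀ i ∉ S, g (X (Sum.inl i)) = 0) (hy : ∀ i ∉ S, g (X (Sum.inr i)) = 0)
    (hrel : ∀ b ∈ B, ∃ c : ι → k, g (X (Sum.inl b)) * g (X (Sum.inr b)) =
      ∑ i ∈ S \ B, algebraMap k Q (c i) * g (X (Sum.inl i)) * g (X (Sum.inr i))) :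
    ringKrullDim Q ≤ (2 * (S \ B).card + B.card : ℕ) := by
  let φ : MvPolynomial (((S \ B : Finset ι) ⊕ (S \ B : Finset ι)) ⊕ B) k →ₐ[k] Q :=
    aeval (Sum.elim (Sum.elim (fun i => g (X (Sum.inl i.1))) (fun i => g (X (Sum.inr i.1))))
      (fun b => g (X (Sum.inl b.1)) - g (X (Sum.inr b.1))))
  have hφx : ∀ i (hi : i ∈ S \ B), φ (X (Sum.inl (Sum.inl ⟨i, hi⟩))) = g (X (Sum.inl i)) := by
    intro i hi; simp [φ]
  have hφy : ∀ i (hi : i ∈ S \ B), φ (X (Sum.inl (Sum.inr ⟨i, hi⟩))) = g (X (Sum.inr i)) := by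
    intro i hi; simp [φ]
  have hφv : ∀ b (hb : b ∈ B), φ (X (Sum.inr ⟨b, hb⟩)) =
      g (X (Sum.inl b)) - g (X (Sum.inr b)) := by
    intro i hi; simp [φ]
  have hBx : ∀ b ∈ B, φ.toRingHom.IsIntegralElem (g (X (Sum.inl b))) := by
    intro b hb
    obtain ⟨c, hc⟩ := hrel b hb
    let w : MvPolynomial (((S \ B : Finset ι) ⊕ (S \ B : Finset ι)) ⊕ B) k :=
      ∑ i ∈ (S \ B).attach, C (c i.1) * X (Sum.inl (Sum.inl i)) * X (Sum.inl (Sum.inr i))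
    have hw : φ w = g (X (Sum.inl b)) * g (X (Sum.inr b)) := by
      rw [hc, ← Finset.sum_attach]
      simp only [w, map_sum, map_mul]
      refine Finset.sum_congr rfl fun i _ => ?_
      rw [hφx i.1 i.2, hφy i.1 i.2, ← algebraMap_eq, AlgHom.commutes]
    let v : MvPolynomial (((S \ B : Finset ι) ⊕ (S \ B : Finset ι)) ⊕ B) k := X (Sum.inr ⟨b, hb⟩)
    refine ⟨Polynomial.X ^ 2 - (Polynomial.C v * Polynomial.X + Polynomial.C w), ?_, ?_⟩
    · apply Polynomial.monic_X_pow_sub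
      refine lt_of_le_of_lt (b := (1 : WithBot ℕ)) (by compute_degree) (by norm_num)
    · have hv : φ v = _ := hφv b hb
      simp only [Polynomial.eval₂_sub, Polynomial.eval₂_add, Polynomial.eval₂_mul,
        Polynomial.eval₂_pow, Polynomial.eval₂_X, Polynomial.eval₂_C]
      change _ - (φ v * _ + φ w) = 0
      rw [hv, hw]
      ring
  have hX : ∀ i, φ.toRingHom.IsIntegralElem (g (X (Sum.inl i))) := by
    intro i
    by_cases hB : i ∈ B
    · exact hBx i hB
    by_cases hS : i ∈ S
    · rw [← hφx i (by simp [hS, hB])]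
      exact φ.toRingHom.isIntegralElem_map
    · rw [hx i hS]; exact RingHom.isIntegralElem_zero _
  have hY : ∀ i, φ.toRingHom.IsIntegralElem (g (X (Sum.inr i))) := by
    intro i
    by_cases hB : i ∈ B
    · have h : g (X (Sum.inr i)) = g (X (Sum.inl i)) - φ.toRingHom (X (Sum.inr ⟨i, hB⟩)) := by
        change _ = _ - φ (X (Sum.inr ⟨i, hB⟩))
        rw [hφv i hB]; ring
      rw [h]
      exact (hBx i hB).sub _ φ.toRingHom.isIntegralElem_map
    by_cases hS : i ∈ S
    · rw [← hφy i (by simp [hS, hB])]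
      exact φ.toRingHom.isIntegralElem_map
    · rw [hy i hS]; exact RingHom.isIntegralElem_zero _
  have hint : φ.toRingHom.IsIntegral := by
    intro z
    obtain ⟨p, rfl⟩ := hg z
    induction p using MvPolynomial.induction_on with
    | C a =>
      have : g (C a) = φ.toRingHom (C a) := by
        change g (C a) = φ (C a)
        rw [← algebraMap_eq, ← algebraMap_eq, AlgHom.commutes, AlgHom.commutes]
      rw [this]; exact φ.toRingHom.isIntegralElem_map
    | add p q hp hq => rw [map_add]; exact hp.add _ hq
    | mul_X p i hp =>
      rw [map_mul]
      refine hp.mul _ ?_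
      rcases i with i | i
      · exact hX i
      · exact hY i
  refine (ringKrullDim_le_of_isIntegral_hom _ hint).trans ?_
  rw [MvPolynomial.ringKrullDim_of_isNoetherianRing, ringKrullDim_eq_zero_of_field, zero_add]
  simp only [Nat.card_eq_fintype_card, Fintype.card_sum, Fintype.card_coe]
  rw [two_mul]

/-- **Codimension `≥ 3` of the non-free locus inside the zero fiber.**
Let `k` be an algebraically closed field of characteristic `0` and let
`β 1, …, β e ∈ ℤ^s` span `ℚ^s`; assume genericity, i.e. removing any one vector
still leaves a spanning set.  Let `S ⊆ {1, …, e}` with `dim_ℚ span{β i : i ∈ S} < s`.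
Then in `R = k[x_1, …, x_e, y_1, …, y_e]` with `q j = ∑ i, β i j * x i * y i`, the
Krull dimension of `R ⧸ (I_S + (q 1, …, q s))`, where `I_S = (x i, y i : i ∉ S)`,
is at most `(2e - s) - 3`; i.e. the intersection of `μ⁻¹(0)` with the coordinate
subspace `W_S` has codimension at least `3` in `μ⁻¹(0)`. -/
theorem zero_fiber_meets_nonfree_locus_in_high_codim
    (k : Type*) [Field k] [IsAlgClosed k] [CharZero k]
    (s e : ℕ) (β : Fin e → Fin s → ℤ)
    (hspan : Submodule.span ℚ (Set.range fun i (j : Fin s) => (β i j : ℚ)) = ⊤)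
    (hgen : ∀ i₀ : Fin e,
      Submodule.span ℚ ((fun i (j : Fin s) => (β i j : ℚ)) '' {i : Fin e | i ≠ i₀}) = ⊤)
    (S : Finset (Fin e))
    (hS : Module.finrank ℚ
      (Submodule.span ℚ ((fun i (j : Fin s) => (β i j : ℚ)) '' (S : Set (Fin e)))) < s) :
    ringKrullDim (MvPolynomial (Fin e ⊕ Fin e) k ⧸
      (Ideal.span ((fun i : Fin e => (X (Sum.inl i) : MvPolynomial (Fin e ⊕ Fin e) k)) ''
            {i : Fin e | i ∉ S} ∪
          (fun i : Fin e => (X (Sum.inr i) : MvPolynomial (Fin e ⊕ Fin e) k)) ''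
            {i : Fin e | i ∉ S}) +
        Ideal.span (Set.range fun j : Fin s =>
          ∑ i : Fin e, C (β i j : k) * X (Sum.inl i) * X (Sum.inr i)))) ≤
      (2 * e - s - 3 : ℕ) := by
  classical
  set v : Fin e → Fin s → ℚ := fun i j => (β i j : ℚ) with hv
  obtain ⟨B₀, hB₀S, -, hB₀span, hB₀⟩ := exists_linearIndepOn_extension (K := ℚ) (v := v)
    (s := ∅) (t := (S : Set (Fin e))) (by simp) (Set.empty_subset _)
  obtain ⟨B, rfl⟩ : ∃ B : Finset (Fin e), (B : Set (Fin e)) = B₀ :=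
    ⟨B₀.toFinite.toFinset, by simp⟩
  have hBS : B ⊆ S := by exact_mod_cast hB₀S
  have hspanBS : Submodule.span ℚ (v '' (S : Set (Fin e))) =
      Submodule.span ℚ (v '' (B : Set (Fin e))) :=
    le_antisymm (Submodule.span_le.2 hB₀span) (Submodule.span_mono (Set.image_mono hB₀S))
  have hcard : Module.finrank ℚ (Submodule.span ℚ (v '' (S : Set (Fin e)))) = B.card := by
    rw [hspanBS, Set.image_eq_range]
    have := finrank_span_eq_card (R := ℚ) (b := fun i : (B : Set (Fin e)) => v i) hB₀
    rw [this]; simp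
  rw [hcard] at hS
  -- counting
  obtain ⟨i₀, hi₀⟩ : ∃ i₀, i₀ ∉ S := by
    by_contra! h
    have h1 : (S : Set (Fin e)) = Set.univ := by ext i; simp [h i]
    rw [h1, Set.image_univ, hspan, finrank_top] at hcard
    simp at hcard
    omega
  have hcount : s ≤ B.card + (Finset.univ \ insert i₀ S).card := by
    have hle : (⊤ : Submodule ℚ (Fin s → ℚ)) ≤ Submodule.span ℚ (v '' (S : Set (Fin e))) ⊔
        Submodule.span ℚ (((Finset.univ \ insert i₀ S).image v : Finset _) : Set (Fin s → ℚ)) := by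
      rw [← hgen i₀, ← Submodule.span_union]
      apply Submodule.span_mono
      rintro _ ⟨i, hi, rfl⟩
      by_cases hiS : i ∈ S
      · exact Or.inl ⟨i, hiS, rfl⟩
      · right
        simp only [Finset.coe_image]
        exact ⟨i, by simpa [hiS] using hi, rfl⟩
    have h1 := Submodule.finrank_mono hle
    rw [finrank_top, Module.finrank_fin_fun] at h1
    refine h1.trans ((Submodule.finrank_add_le_finrank_add_finrank _ _).trans ?_)
    rw [hcard]
    gcongr
    exact (finrank_span_finset_le_card _).trans Finset.card_image_le
  have hc1 : (Finset.univ \ insert i₀ S).card + (S.card + 1) = e := by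
    have := Finset.card_sdiff_add_card_eq_card (Finset.subset_univ (insert i₀ S))
    rwa [Finset.card_insert_of_notMem hi₀, Finset.card_univ, Fintype.card_fin] at this
  have hc2 : (S \ B).card + B.card = S.card := Finset.card_sdiff_add_card_eq_card hBS
  -- dual functionals
  obtain ⟨ψ, hψ⟩ := LinearMap.exists_leftInverse_of_injective
    (Finsupp.linearCombination ℚ (fun i : (B : Set (Fin e)) => v i))
    (LinearMap.ker_eq_bot.2 hB₀)
  have hψ' : ∀ b : (B : Set (Fin e)), ψ (v b) = Finsupp.single b 1 := by
    intro b
    have := LinearMap.congr_fun hψ (Finsupp.single b 1)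
    simpa using this
  set I : Ideal (MvPolynomial (Fin e ⊕ Fin e) k) := _ + _ with hI
  have hfin : ringKrullDim (MvPolynomial (Fin e ⊕ Fin e) k ⧸ I) ≤
      (2 * (S \ B).card + B.card : ℕ) := by
    have hx : ∀ i ∉ S, Ideal.Quotient.mkₐ k I (X (Sum.inl i)) = 0 := fun i hi =>
      Ideal.Quotient.eq_zero_iff_mem.2
        (Submodule.mem_sup_left (Ideal.subset_span (Or.inl ⟨i, hi, rfl⟩)))
    have hy : ∀ i ∉ S, Ideal.Quotient.mkₐ k I (X (Sum.inr i)) = 0 := fun i hi =>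
      Ideal.Quotient.eq_zero_iff_mem.2
        (Submodule.mem_sup_left (Ideal.subset_span (Or.inr ⟨i, hi, rfl⟩)))
    refine ringKrullDim_le_of_relations (Ideal.Quotient.mkₐ k I)
      (Ideal.Quotient.mkₐ_surjective k I) S B hx hy ?_
    have hq : ∀ j, ∑ i : Fin e, algebraMap k (MvPolynomial (Fin e ⊕ Fin e) k ⧸ I) (β i j : k) *
        Ideal.Quotient.mkₐ k I (X (Sum.inl i)) * Ideal.Quotient.mkₐ k I (X (Sum.inr i)) = 0 := by
      intro j
      have h : Ideal.Quotient.mkₐ k I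
          (∑ i : Fin e, C (β i j : k) * X (Sum.inl i) * X (Sum.inr i)) = 0 :=
        Ideal.Quotient.eq_zero_iff_mem.2
          (Submodule.mem_sup_right (Ideal.subset_span ⟨j, rfl⟩))
      rw [← h, map_sum]
      refine Finset.sum_congr rfl fun i _ => ?_
      rw [map_mul, map_mul, ← algebraMap_eq, AlgHom.commutes]
    generalize Ideal.Quotient.mkₐ k I = g at hx hy hq ⊢
    intro b hb
    let c : Fin e → ℚ := fun i => ψ (v i) ⟨b, hb⟩
    let d : Fin s → ℚ := fun j => ψ (Pi.single j 1) ⟨b, hb⟩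
    have hcd : ∀ i, c i = ∑ j, d j * (β i j : ℚ) := by
      intro i
      have h1 : v i = ∑ j, (β i j : ℚ) • (Pi.single j 1 : Fin s → ℚ) := by
        rw [← pi_eq_sum_univ' (v i)]
      simp only [c, d]
      rw [h1, map_sum, Finsupp.finsetSum_apply]
      refine Finset.sum_congr rfl fun j _ => ?_
      rw [map_smul, Finsupp.smul_apply, smul_eq_mul, mul_comm]
    have hsum : ∑ i : Fin e, algebraMap k (MvPolynomial (Fin e ⊕ Fin e) k ⧸ I) (c i : k) *
        g (X (Sum.inl i)) * g (X (Sum.inr i)) = 0 := by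
      have h2 : ∑ j, algebraMap k (MvPolynomial (Fin e ⊕ Fin e) k ⧸ I) (d j : k) *
          ∑ i : Fin e, algebraMap k (MvPolynomial (Fin e ⊕ Fin e) k ⧸ I) (β i j : k) *
          g (X (Sum.inl i)) * g (X (Sum.inr i)) = 0 :=
        Finset.sum_eq_zero fun j _ => by rw [hq j, mul_zero]
      rw [← h2]
      simp only [Finset.mul_sum]
      rw [Finset.sum_comm]
      refine Finset.sum_congr rfl fun i _ => ?_
      have hck : (c i : k) = ∑ j, (d j : k) * (β i j : k) := by
        rw [hcd i]; push_cast; rfl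
      rw [hck, map_sum, Finset.sum_mul, Finset.sum_mul]
      refine Finset.sum_congr rfl fun j _ => ?_
      rw [map_mul]; ring
    refine ⟨fun i => -(c i : k), ?_⟩
    have hS0 : ∑ i ∈ S, algebraMap k (MvPolynomial (Fin e ⊕ Fin e) k ⧸ I) (c i : k) *
        g (X (Sum.inl i)) * g (X (Sum.inr i)) = 0 := by
      rw [← hsum]
      refine Finset.sum_subset (Finset.subset_univ _) fun i _ hi => ?_
      rw [hx i hi]; ring
    rw [← Finset.sum_sdiff hBS] at hS0
    have hB1 : ∑ i ∈ B, algebraMap k (MvPolynomial (Fin e ⊕ Fin e) k ⧸ I) (c i : k) *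
        g (X (Sum.inl i)) * g (X (Sum.inr i)) = g (X (Sum.inl b)) * g (X (Sum.inr b)) := by
      rw [Finset.sum_eq_single_of_mem b hb]
      · have : c b = 1 := by
          simp only [c]; rw [hψ' ⟨b, hb⟩]; simp
        rw [this]; simp
      · intro i hi hib
        have : c i = 0 := by
          simp only [c]; rw [hψ' ⟨i, hi⟩]
          exact Finsupp.single_eq_of_ne (by simpa using hib.symm)
        rw [this]; simp
    rw [hB1] at hS0
    rw [eq_neg_of_add_eq_zero_right hS0, ← Finset.sum_neg_distrib]
    refine Finset.sum_congr rfl fun i _ => ?_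
    rw [map_neg]; ring
  refine hfin.trans ?_
  exact_mod_cast (by omega : 2 * (S \ B).card + B.card ≤ 2 * e - s - 3)
end

section
/- Assume that β_1, ..., β_e span ℚ^s and that for every index i_0 ∈ {1, ..., e} the remaining vectors { β_i : i ≠ i_0 } still span ℚ^s (genericity of the representation W). Then the quotient ring R/(q_1, ..., q_s) is a normal domain, i.e. it is an integral domain which is integrally closed in its field of fractions. That is, the zero fiber μ^{-1}(0) of the moment map is a normal variety. -/
section core
universe u

theorem zf_semi {A L : Type u} [CommRing A] [IsDomain A] [CommRing L] [IsDomain L]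
    [IsIntegrallyClosed L] (φ : A →+* L) (hφ : Function.Injective φ) (x : A)
    (hx : ∀ l : L, ∃ (N : ℕ) (a : A), φ a = l * φ x ^ N)
    (z : FractionRing A) (hz : IsIntegral A z) :
    ∃ (N : ℕ) (a : A), algebraMap A (FractionRing A) a = z * algebraMap A _ x ^ N := by
  let ψ : FractionRing A →+* FractionRing L :=
    IsFractionRing.lift (A := A) (g := (algebraMap L (FractionRing L)).comp φ)
      ((IsFractionRing.injective L (FractionRing L)).comp hφ)
  have hψ : ∀ a, ψ (algebraMap A _ a) = algebraMap L _ (φ a) := fun a => by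
    simp only [ψ, IsFractionRing.lift_algebraMap, RingHom.comp_apply]
  have hint : IsIntegral L (ψ z) := by
    refine hz.map_of_comp_eq φ ψ ?_
    ext a
    simp [hψ]
  obtain ⟨l, hl⟩ := (isIntegrallyClosed_iff (FractionRing L)).1 inferInstance hint
  obtain ⟨N, a, ha⟩ := hx l
  refine ⟨N, a, ψ.injective ?_⟩
  rw [map_mul, map_pow, hψ, hψ, ha, ← hl, map_mul, map_pow]

theorem zf_normal_of {A L : Type u} [CommRing A] [IsDomain A] [CommRing L] [IsDomain L]
    [IsIntegrallyClosed L] (φ φ' : A →+* L) (hφ : Function.Injective φ)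
    (hφ' : Function.Injective φ') (x y : A) (hx0 : x ≠ 0)
    (hx : ∀ l : L, ∃ (N : ℕ) (a : A), φ a = l * φ x ^ N)
    (hy : ∀ l : L, ∃ (N : ℕ) (a : A), φ' a = l * φ' y ^ N)
    (hxy : ∀ a, x ∣ a * y → x ∣ a) : IsIntegrallyClosed A := by
  have hxy2 : ∀ M a, x ∣ a * y ^ M → x ∣ a := by
    intro M
    induction M with
    | zero => intro a h; simpa using h
    | succ M ih => intro a h; exact ih a (hxy _ (by rwa [mul_assoc, ← pow_succ]))
  have hxy3 : ∀ N M a, x ^ N ∣ a * y ^ M → x ^ N ∣ a := by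
    intro N M
    induction N with
    | zero => intro a _; simp
    | succ N ih =>
      intro a h
      obtain ⟨c, rfl⟩ := hxy2 M a ((dvd_pow_self x (Nat.succ_ne_zero N)).trans h)
      rw [pow_succ', mul_assoc] at h
      rw [pow_succ']
      exact mul_dvd_mul_left x (ih c ((mul_dvd_mul_iff_left hx0).1 h))
  rw [isIntegrallyClosed_iff (FractionRing A)]
  intro z hz
  obtain ⟨N, a, ha⟩ := zf_semi φ hφ x hx z hz
  obtain ⟨M, b, hb⟩ := zf_semi φ' hφ' y hy z hz
  have hinj := IsFractionRing.injective A (FractionRing A)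
  have h1 : a * y ^ M = x ^ N * b := by
    apply hinj
    simp only [map_mul, map_pow, ha, hb]
    ring
  obtain ⟨c, rfl⟩ := hxy3 N M a ⟨b, h1⟩
  refine ⟨c, ?_⟩
  have h0 : algebraMap A (FractionRing A) x ^ N ≠ 0 := by
    apply pow_ne_zero
    rwa [Ne, map_eq_zero_iff _ hinj]
  rw [map_mul, map_pow, mul_comm] at ha
  exact mul_right_cancel₀ h0 ha

open Polynomial in
theorem zf_step {B : Type u} [CommRing B] [IsDomain B] [IsIntegrallyClosed B] (l : B)
    (hl : l ≠ 0) : ∃ (A : Type u) (_ : CommRing A) (_ : IsDomain A) (_ : IsIntegrallyClosed A)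
    (f : B →+* A) (x y : A), Function.Injective f ∧ x * y = f l ∧
    ∀ (S : Type u) [CommRing S] (g : B →+* S) (a b : S), a * b = g l →
      ∃! h : A →+* S, h.comp f = g ∧ h x = a ∧ h y = b := by
  let p : B[X][X] := C X * X - C (C l)
  let A := AdjoinRoot p
  let f : B →+* A := (AdjoinRoot.of p).comp C
  let x : A := AdjoinRoot.of p X
  let y : A := AdjoinRoot.root p
  have hxy : x * y = f l := by
    have h : AdjoinRoot.mk p p = 0 := AdjoinRoot.mk_self
    have h2 : AdjoinRoot.mk p p = x * y - f l := by
      conv_lhs => arg 2; simp only [p]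
      simp only [map_sub, map_mul, AdjoinRoot.mk_C, AdjoinRoot.mk_X]
      rfl
    rw [h] at h2
    exact (sub_eq_zero.1 h2.symm)
  have huniv : ∀ {S : Type u} [CommRing S] (g : B →+* S) (a b : S), a * b = g l →
      ∃! h : A →+* S, h.comp f = g ∧ h x = a ∧ h y = b := by
    intro S _ g a b hab
    have hp : eval₂ (eval₂RingHom g a) b p = 0 := by simp [p, hab]
    refine ⟨AdjoinRoot.lift (eval₂RingHom g a) b hp, ⟨?_, ?_, ?_⟩, ?_⟩
    · ext r
      exact (AdjoinRoot.lift_of hp).trans (by simp)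
    · exact (AdjoinRoot.lift_of hp).trans (by simp)
    · exact AdjoinRoot.lift_root hp
    · rintro h ⟨h1, h2, h3⟩
      apply AdjoinRoot.ringHom_ext
      · ext r
        · simpa [f] using congrArg (fun t => t r) h1
        · simpa [x] using h2
      · simpa [y] using h3
  -- x is a nonzerodivisor
  have hreg : ∀ a : A, x * a = 0 → a = 0 := by
    intro a
    induction a using AdjoinRoot.induction_on with | _ g => ?_
    intro h
    have h' : AdjoinRoot.mk p (C X * g) = 0 := by
      rw [map_mul, AdjoinRoot.mk_C]; exact h
    rw [AdjoinRoot.mk_eq_zero] at h' ⊢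
    obtain ⟨q, hq⟩ := h'
    have hP : Prime (C X : B[X][X]) := Polynomial.prime_C_iff.2 Polynomial.prime_X
    rcases hP.dvd_or_dvd (⟨g, hq.symm⟩ : C X ∣ p * q) with h1 | h1
    · exfalso
      have := (C_dvd_iff_dvd_coeff _ _).1 h1 0
      simp [p, X_dvd_iff, hl] at this
    · obtain ⟨q', rfl⟩ := h1
      exact ⟨q', mul_left_cancel₀ hP.ne_zero (by rw [hq]; ring)⟩
  have hclear : ∀ a : A, ∃ (N : ℕ) (q : B[X]), x ^ N * a = AdjoinRoot.of p q := by
    intro a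
    induction a using AdjoinRoot.induction_on with | _ g => ?_
    induction g using Polynomial.induction_on' with
    | add g h hg hh =>
      obtain ⟨N, q, hq⟩ := hg
      obtain ⟨M, r, hr⟩ := hh
      refine ⟨N + M, X ^ M * q + X ^ N * r, ?_⟩
      simp only [map_add, map_mul, map_pow, ← hq, ← hr]
      change x ^ (N + M) * _ = x ^ M * _ + x ^ N * _
      ring
    | monomial n c =>
      refine ⟨n, c * C l ^ n, ?_⟩
      rw [← C_mul_X_pow_eq_monomial]
      simp only [map_mul, map_pow, AdjoinRoot.mk_C, AdjoinRoot.mk_X]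
      change x ^ n * (_ * y ^ n) = _ * f l ^ n
      rw [← hxy]; ring
  obtain ⟨φ, ⟨hφf, hφx, hφy⟩, -⟩ := huniv (S := LaurentPolynomial B) (LaurentPolynomial.C)
    (LaurentPolynomial.T 1) (LaurentPolynomial.C l * LaurentPolynomial.T (-1)) (by
      rw [mul_left_comm, ← LaurentPolynomial.T_add]; simp)
  have hφq : ∀ q, φ (AdjoinRoot.of p q) = toLaurent q := by
    intro q
    have : φ.comp (AdjoinRoot.of p) = toLaurent := by
      apply Polynomial.ringHom_ext
      · intro r
        rw [toLaurent_C]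
        exact congrArg (fun t => t r) hφf
      · rw [toLaurent_X]
        exact hφx
    exact congrArg (fun t => t q) this
  have hφ : Function.Injective φ := by
    rw [injective_iff_map_eq_zero]
    intro a ha
    obtain ⟨N, q, hq⟩ := hclear a
    have : toLaurent q = 0 := by rw [← hφq, ← hq, map_mul, ha, mul_zero]
    have hq0 : q = 0 := toLaurent_injective (by rw [this, map_zero])
    rw [hq0, map_zero] at hq
    clear this
    induction N with
    | zero => simpa using hq
    | succ N ih => exact ih (hreg _ (by rw [← hq]; ring))
  have : IsDomain (LaurentPolynomial B) :=
    IsLocalization.isDomain_of_le_nonZeroDivisors _ (M := Submonoid.powers (X : B[X]))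
      (powers_le_nonZeroDivisors_of_noZeroDivisors X_ne_zero)
  have : IsIntegrallyClosed (LaurentPolynomial B) :=
    isIntegrallyClosed_of_isLocalization _ (Submonoid.powers (X : B[X]))
      (powers_le_nonZeroDivisors_of_noZeroDivisors X_ne_zero)
  have : IsDomain A := hφ.isDomain φ
  have hx0 : x ≠ 0 := by
    intro h
    have := hreg 1 (by rw [h, zero_mul])
    exact one_ne_zero this
  have hφl : ∀ t : LaurentPolynomial B, ∃ (N : ℕ) (a : A), φ a = t * φ x ^ N := by
    intro t
    obtain ⟨n, q, hq⟩ := LaurentPolynomial.exists_T_pow t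
    refine ⟨n, AdjoinRoot.of p q, ?_⟩
    rw [hφq, hq, hφx, LaurentPolynomial.T_pow]; simp
  obtain ⟨σ, ⟨hσf, hσx, hσy⟩, -⟩ := huniv f y x (by rw [mul_comm, hxy])
  have hσσ : σ.comp σ = RingHom.id A := by
    obtain ⟨i, -, hi⟩ := huniv f x y hxy
    rw [hi (σ.comp σ) ⟨by rw [RingHom.comp_assoc, hσf, hσf], by simp [hσx, hσy],
      by simp [hσx, hσy]⟩, hi (RingHom.id A) ⟨by simp, rfl, rfl⟩]
  have hσσ' : ∀ a, σ (σ a) = a := fun a => congrArg (fun t => t a) hσσ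
  have hσ : Function.Injective σ := Function.LeftInverse.injective hσσ'
  obtain ⟨χ, ⟨hχf, hχx, hχy⟩, -⟩ := huniv (S := (B ⧸ Ideal.span {l})[X])
    (C.comp (Ideal.Quotient.mk (Ideal.span {l}))) 0 X (by
      simp [Ideal.Quotient.eq_zero_iff_mem.2 (Ideal.mem_span_singleton_self l)])
  have hred : ∀ a : A, ∃ q : B[X], x ∣ a - eval₂ f y q := by
    intro a
    induction a using AdjoinRoot.induction_on with | _ g => ?_
    induction g using Polynomial.induction_on' with
    | add g h hg hh =>
      obtain ⟨q, hq⟩ := hg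
      obtain ⟨r, hr⟩ := hh
      refine ⟨q + r, ?_⟩
      have := dvd_add hq hr
      rw [map_add, eval₂_add]
      convert this using 1
      ring
    | monomial n c =>
      refine ⟨monomial n (c.coeff 0), ?_⟩
      rw [← C_mul_X_pow_eq_monomial, eval₂_monomial]
      simp only [map_mul, map_pow, AdjoinRoot.mk_C, AdjoinRoot.mk_X]
      change x ∣ _ * y ^ n - AdjoinRoot.of p (C (c.coeff 0)) * y ^ n
      rw [← sub_mul, ← map_sub]
      apply Dvd.dvd.mul_right
      apply _root_.map_dvd
      simp [X_dvd_iff]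
  have hker : ∀ a, χ a = 0 → x ∣ a := by
    intro a ha
    obtain ⟨q, hq⟩ := hred a
    have h1 : χ (eval₂ f y q) = 0 := by
      have := _root_.map_dvd χ hq
      rw [hχx, zero_dvd_iff, map_sub, ha, zero_sub, neg_eq_zero] at this
      exact this
    rw [hom_eval₂, hχf, hχy] at h1
    have h2 : q.map (Ideal.Quotient.mk (Ideal.span {l})) = 0 := by
      rw [← h1]; rfl
    have h3 : C l ∣ q := by
      rw [C_dvd_iff_dvd_coeff]
      intro i
      have := congrArg (fun t => coeff t i) h2
      simp only [coeff_map, coeff_zero] at this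
      rwa [Ideal.Quotient.eq_zero_iff_mem, Ideal.mem_span_singleton] at this
    obtain ⟨r, rfl⟩ := h3
    have h4 : x ∣ eval₂ f y (C l * r) := by
      rw [eval₂_mul, eval₂_C, ← hxy, mul_assoc]
      exact dvd_mul_right _ _
    simpa using dvd_add hq h4
  have hIC : IsIntegrallyClosed A := by
    refine zf_normal_of φ (φ.comp σ) hφ (hφ.comp hσ) x y hx0 hφl ?_ ?_
    · intro t
      obtain ⟨N, a, ha⟩ := hφl t
      exact ⟨N, σ a, by simp [hσσ', hσy, ha]⟩
    · intro a ha
      apply hker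
      have := _root_.map_dvd χ ha
      rw [hχx, zero_dvd_iff, map_mul, hχy] at this
      exact (Polynomial.isRegular_X.right.mul_right_eq_zero_iff).1 this
  refine ⟨A, inferInstance, inferInstance, hIC, f, x, y, ?_, hxy, fun S _ g a b h => huniv g a b h⟩
  have : Function.Injective (φ.comp f) := by
    rw [hφf]
    intro a b hab
    rw [← toLaurent_C, ← toLaurent_C] at hab
    exact C_injective (toLaurent_injective hab)
  exact Function.Injective.of_comp (f := φ) this

theorem zf_iter (n : ℕ) : ∀ {B : Type u} [CommRing B] [IsDomain B] [IsIntegrallyClosed B]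
    (l : Fin n → B) (_ : ∀ i, l i ≠ 0), ∃ (A : Type u) (_ : CommRing A) (_ : IsDomain A)
    (_ : IsIntegrallyClosed A)
    (f : B →+* A) (x y : Fin n → A), (∀ i, x i * y i = f (l i)) ∧
    ∀ (S : Type u) [CommRing S] (g : B →+* S) (a b : Fin n → S), (∀ i, a i * b i = g (l i)) →
      ∃! h : A →+* S, h.comp f = g ∧ (∀ i, h (x i) = a i) ∧ ∀ i, h (y i) = b i := by
  induction n with
  | zero =>
    intro B _ _ _ l hl
    refine ⟨B, inferInstance, inferInstance, inferInstance, RingHom.id B, fun _ => 0, fun _ => 0,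
      fun i => i.elim0, fun S _ g a b _ => ⟨g, ⟨by simp, fun i => i.elim0, fun i => i.elim0⟩, ?_⟩⟩
    rintro h ⟨h1, -, -⟩
    simpa using h1
  | succ n ih =>
    intro B _ _ _ l hl
    obtain ⟨A, _, _, _, f, x, y, hf, hxy, hu⟩ := zf_step (l 0) (hl 0)
    obtain ⟨A', _, _, _, f', x', y', hxy', hu'⟩ := ih (fun i : Fin n => f (l i.succ)) (fun i => by
      rw [Ne, map_eq_zero_iff f hf]; exact hl _)
    refine ⟨A', inferInstance, inferInstance, inferInstance, f'.comp f, Fin.cons (f' x) x',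
      Fin.cons (f' y) y', ?_, ?_⟩
    · intro i
      refine Fin.cases ?_ (fun i => ?_) i
      · simp [← hxy]
      · simp [hxy']
    · intro S _ g a b hab
      obtain ⟨h, ⟨h1, h2, h3⟩, hh⟩ := hu S g (a 0) (b 0) (hab 0)
      obtain ⟨h', ⟨h1', h2', h3'⟩, hh'⟩ := hu' S h (fun i => a i.succ) (fun i => b i.succ) (by
        intro i
        rw [hab, ← h1]; rfl)
      refine ⟨h', ⟨?_, ?_, ?_⟩, ?_⟩
      · rw [← RingHom.comp_assoc, h1', h1]
      · intro i
        refine Fin.cases ?_ (fun i => ?_) i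
        · simp [← h2, ← h1']
        · simp [h2']
      · intro i
        refine Fin.cases ?_ (fun i => ?_) i
        · simp [← h3, ← h1']
        · simp [h3']
      · rintro t ⟨t1, t2, t3⟩
        apply hh'
        refine ⟨?_, fun i => ?_, fun i => ?_⟩
        · apply hh
          refine ⟨by rw [← t1, RingHom.comp_assoc], ?_, ?_⟩
          · simpa using t2 0
          · simpa using t3 0
        · simpa using t2 i.succ
        · simpa using t3 i.succ

end core

theorem zf_not_mem
    (k : Type*) [Field k] [CharZero k]
    (s e : ℕ) (β : Fin e → Fin s → ℤ)
    (hgen : ∀ i₀ : Fin e,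
      Submodule.span ℚ ((fun i (j : Fin s) => (β i j : ℚ)) '' {i : Fin e | i ≠ i₀}) = ⊤)
    (i₀ : Fin e) :
    (Pi.single i₀ 1 : Fin e → k) ∉
      Submodule.span k (Set.range fun (j : Fin s) (i : Fin e) => (β i j : k)) := by
  intro hmem
  rw [Submodule.mem_span_range_iff_exists_fun] at hmem
  obtain ⟨c, hc⟩ := hmem
  have hc' : ∀ i, ∑ j, c j * (β i j : k) = (Pi.single i₀ 1 : Fin e → k) i := by
    intro i
    rw [← hc]; simp
  let φ : (Fin s → ℚ) →ₗ[ℚ] k := ∑ j, (LinearMap.toSpanSingleton ℚ k (c j)).comp (LinearMap.proj j)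
  have hφ : ∀ i, φ (fun j => (β i j : ℚ)) = (Pi.single i₀ 1 : Fin e → k) i := by
    intro i
    rw [← hc' i]
    simp [φ, LinearMap.sum_apply, Algebra.smul_def, mul_comm]
  have h0 : φ = 0 := by
    apply LinearMap.ext_on (hgen i₀)
    rintro _ ⟨i, hi, rfl⟩
    have := hφ i
    rw [Pi.single_eq_of_ne hi] at this
    simpa using this
  have := hφ i₀
  rw [h0] at this
  simp at this

theorem zf_sym_ι_ne {k V : Type*} [Field k] [AddCommGroup V] [Module k V] (v : V) (hv : v ≠ 0) :
    SymmetricAlgebra.ι k V v ≠ 0 := by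
  intro h
  obtain ⟨g, hg⟩ := Module.Projective.exists_dual_ne_zero k hv
  apply hg
  rw [← SymmetricAlgebra.lift_ι_apply g v, h, map_zero]

open MvPolynomial

/-- **Normality of the zero fiber of the moment map.**
Let `k` be an algebraically closed field of characteristic `0` and let
`β 1, …, β e ∈ ℤ^s` span `ℚ^s`; assume genericity, i.e. for every `i₀` the vectors
`{β i : i ≠ i₀}` still span `ℚ^s`.  Then with `q j = ∑ i, β i j * x i * y i` in
`R = k[x_1, …, x_e, y_1, …, y_e]`, the quotient `R ⧸ (q 1, …, q s)` is a normal
domain: an integral domain which is integrally closed in its fraction field.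
That is, `μ⁻¹(0)` is a normal variety. -/
theorem zero_fiber_normal
    (k : Type*) [Field k] [IsAlgClosed k] [CharZero k]
    (s e : ℕ) (β : Fin e → Fin s → ℤ)
    (hspan : Submodule.span ℚ (Set.range fun i (j : Fin s) => (β i j : ℚ)) = ⊤)
    (hgen : ∀ i₀ : Fin e,
      Submodule.span ℚ ((fun i (j : Fin s) => (β i j : ℚ)) '' {i : Fin e | i ≠ i₀}) = ⊤) :
    IsDomain (MvPolynomial (Fin e ⊕ Fin e) k ⧸
        Ideal.span (Set.range fun j : Fin s =>
          ∑ i : Fin e, C (β i j : k) * X (Sum.inl i) * X (Sum.inr i))) ∧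
      IsIntegrallyClosed (MvPolynomial (Fin e ⊕ Fin e) k ⧸
        Ideal.span (Set.range fun j : Fin s =>
          ∑ i : Fin e, C (β i j : k) * X (Sum.inl i) * X (Sum.inr i))) := by
  classical
  set I := Ideal.span (Set.range fun j : Fin s =>
          ∑ i : Fin e, C (β i j : k) * X (Sum.inl i) * X (Sum.inr i) :
            Set (MvPolynomial (Fin e ⊕ Fin e) k)) with hI
  let W := Submodule.span k (Set.range fun (j : Fin s) (i : Fin e) => (β i j : k))
  let V := (Fin e → k) ⧸ W
  let B := SymmetricAlgebra k V
  have hB : IsIntegrallyClosed B :=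
    IsIntegrallyClosed.of_equiv
      (SymmetricAlgebra.equivMvPolynomial (Module.Basis.ofVectorSpace k V)).toRingEquiv.symm
  let l : Fin e → B := fun i => SymmetricAlgebra.ι k V (W.mkQ (Pi.single i 1))
  have hl : ∀ i, l i ≠ 0 := by
    intro i
    apply zf_sym_ι_ne
    rw [Submodule.mkQ_apply, Ne, Submodule.Quotient.mk_eq_zero]
    exact zf_not_mem k s e β hgen i
  have hlsum : ∀ c : Fin e → k, ∑ i, algebraMap k B (c i) * l i =
      SymmetricAlgebra.ι k V (W.mkQ c) := by
    intro c
    conv_rhs => rw [← Finset.univ_sum_single c]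
    rw [map_sum, map_sum]
    refine Finset.sum_congr rfl fun i _ => ?_
    rw [← Algebra.smul_def, ← map_smul, ← map_smul, ← Pi.single_smul]
    simp
  obtain ⟨A, _, _, _, f, x, y, hxy, hu⟩ := zf_iter e l hl
  -- the map from the quotient to A
  let Φ0 : MvPolynomial (Fin e ⊕ Fin e) k →+* A :=
    eval₂Hom (f.comp (algebraMap k B)) (Sum.elim x y)
  have hΦ0 : ∀ a ∈ I, Φ0 a = 0 := by
    intro a ha
    have : I ≤ RingHom.ker Φ0 := by
      rw [hI, Ideal.span_le]
      rintro _ ⟨j, rfl⟩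
      rw [SetLike.mem_coe, RingHom.mem_ker, map_sum]
      have h1 : ∀ i, Φ0 (C (β i j : k) * X (Sum.inl i) * X (Sum.inr i)) =
          f (algebraMap k B (β i j : k) * l i) := by
        intro i
        rw [map_mul, map_mul, map_mul, ← hxy, ← mul_assoc]
        simp [Φ0]
      rw [Finset.sum_congr rfl fun i _ => h1 i, ← map_sum, hlsum fun i => (β i j : k)]
      have h2 : W.mkQ (fun i => (β i j : k)) = 0 := by
        rw [Submodule.mkQ_apply, Submodule.Quotient.mk_eq_zero]
        exact Submodule.subset_span ⟨j, rfl⟩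
      rw [h2, map_zero, map_zero]
    exact this ha
  let Φ : MvPolynomial (Fin e ⊕ Fin e) k ⧸ I →+* A := Ideal.Quotient.lift I Φ0 hΦ0
  -- the map from A to the quotient
  let xq : Fin e → MvPolynomial (Fin e ⊕ Fin e) k ⧸ I := fun i =>
    Ideal.Quotient.mk I (X (Sum.inl i))
  let yq : Fin e → MvPolynomial (Fin e ⊕ Fin e) k ⧸ I := fun i =>
    Ideal.Quotient.mk I (X (Sum.inr i))
  let γ0 : (Fin e → k) →ₗ[k] MvPolynomial (Fin e ⊕ Fin e) k ⧸ I :=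
    ∑ i, (LinearMap.toSpanSingleton k _ (xq i * yq i)).comp (LinearMap.proj i)
  have hγ0 : ∀ c, γ0 c = ∑ i, c i • (xq i * yq i) := by
    intro c
    simp [γ0, LinearMap.sum_apply]
  have hγW : W ≤ LinearMap.ker γ0 := by
    rw [Submodule.span_le]
    rintro _ ⟨j, rfl⟩
    rw [SetLike.mem_coe, LinearMap.mem_ker, hγ0]
    have : Ideal.Quotient.mk I (∑ i : Fin e, C (β i j : k) * X (Sum.inl i) * X (Sum.inr i)) = 0 :=
      Ideal.Quotient.eq_zero_iff_mem.2 (Ideal.subset_span ⟨j, rfl⟩)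
    rw [← this, map_sum]
    refine Finset.sum_congr rfl fun i _ => ?_
    rw [map_mul, map_mul, mul_assoc]
    exact Algebra.smul_def (β i j : k) (xq i * yq i)
  let g : B →ₐ[k] MvPolynomial (Fin e ⊕ Fin e) k ⧸ I :=
    SymmetricAlgebra.lift (W.liftQ γ0 hγW)
  have hg : ∀ i, xq i * yq i = g (l i) := by
    intro i
    simp only [g, l]
    rw [SymmetricAlgebra.lift_ι_apply, Submodule.mkQ_apply, Submodule.liftQ_apply, hγ0,
      Finset.sum_eq_single i]
    · simp
    · intro b _ hb
      simp [hb]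
    · simp
  obtain ⟨Ψ, ⟨hΨf, hΨx, hΨy⟩, -⟩ := hu _ (g : B →+* _) xq yq hg
  have hΦx : ∀ i, Φ (xq i) = x i := by
    intro i
    simp [Φ, xq, Φ0]
  have hΦy : ∀ i, Φ (yq i) = y i := by
    intro i
    simp [Φ, yq, Φ0]
  have hΦk : ∀ c : k, Φ (Ideal.Quotient.mk I (C c)) = f (algebraMap k B c) := by
    intro c
    simp [Φ, Φ0]
  have hΨΦ : Ψ.comp Φ = RingHom.id _ := by
    apply Ideal.Quotient.ringHom_ext
    apply MvPolynomial.ringHom_ext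
    · intro c
      rw [RingHom.comp_apply, RingHom.comp_apply, hΦk, ← RingHom.comp_apply, hΨf]
      exact g.commutes c
    · rintro (i | i)
      · exact (congrArg Ψ (hΦx i)).trans (hΨx i)
      · exact (congrArg Ψ (hΦy i)).trans (hΨy i)
  have hΦΨ : Φ.comp Ψ = RingHom.id _ := by
    obtain ⟨t, -, ht⟩ := hu A f x y hxy
    rw [ht (Φ.comp Ψ) ⟨?_, fun i => by rw [RingHom.comp_apply, hΨx, hΦx],
      fun i => by rw [RingHom.comp_apply, hΨy, hΦy]⟩,
      ht (RingHom.id A) ⟨by simp, fun _ => rfl, fun _ => rfl⟩]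
    rw [RingHom.comp_assoc, hΨf]
    let _ : Algebra k A := (f.comp (algebraMap k B)).toAlgebra
    let F : B →ₐ[k] A := { f with commutes' := fun c => rfl }
    let G : B →ₐ[k] A := { Φ.comp (g : B →+* _) with
      commutes' := fun c => (congrArg Φ (g.commutes c)).trans (hΦk c) }
    have hFG : G = F := by
      apply SymmetricAlgebra.algHom_ext
      apply Submodule.linearMap_qext
      apply LinearMap.pi_ext'
      intro i
      apply LinearMap.ext_ring
      change Φ (g (l i)) = f (l i)
      rw [← hg, map_mul, hΦx, hΦy, hxy]
    exact congrArg (fun t : B →ₐ[k] A => (t : B →+* A)) hFG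
  let E : A ≃+* MvPolynomial (Fin e ⊕ Fin e) k ⧸ I := RingEquiv.ofRingHom Ψ Φ hΨΦ hΦΨ
  exact ⟨E.symm.injective.isDomain (E.symm : _ →+* A), IsIntegrallyClosed.of_equiv E⟩
end
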